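/- arXiv:2508.02859 — 2 statements merged into one kernel-verified Lean document; each statement's English description precedes it below -/
import Mathlib

section
/- Let p be an odd prime, q = p^r with q ≡ 1 (mod 4), and s = v₂(q−1). Let k be a field of characteristic ≠ 2 and let ε be a primitive 2^s-th root of unity in a fixed algebraic closure of k. Let n ≥ 2 and let P be any Sylow 2-subgroup of PGL_n(F_q). Then the minimal faithful representation dimension of P over k equals: (n−1)·[k(ε):k] if n is odd; 2^{v₂(n)}·(n−2^{v₂(n)})·[k(ε):k] if n is even and n is not a power of 2; and, if n = 2^t, it equals 2^{2t−2}·[k(ε):k] when there exists a k-algebra automorphism of k(ε) sending ε to ε⁻¹, and 2^{2t−1}·[k(ε):k] when no such automorphism exists. -/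
open IntermediateField

/-- The minimal faithful representation dimension of a group `G` over a field `k`:
the least `d` such that there is an injective group homomorphism `G →* GL d k`. -/
noncomputable def minFaithfulDim (k : Type*) [Field k] (G : Type*) [Group G] : ℕ :=
  sInf {d : ℕ | ∃ φ : G →* Matrix.GeneralLinearGroup (Fin d) k, Function.Injective φ}

namespace SylowPGL

/-- A permutation agreeing on `A` with an element of a normal subgroup `K` of a Sylow `2`-subgroup
`Q`, and on the complement of `A` with another element of `K`, belongs to `Q`, provided `K`
preserves `A` and `Q` permutes `A` and its complement. -/
theorem mem_sylow_of_agree {α : Type*} [Finite α] (Q : Sylow 2 (Equiv.Perm α))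
    (K : Subgroup (Equiv.Perm α)) (hKQ : ∀ g ∈ K, g ∈ Q)
    (hnorm : ∀ q ∈ Q, ∀ g ∈ K, q * g * q⁻¹ ∈ K) (A : Set α)
    (hA : ∀ g ∈ K, ∀ x, g x ∈ A ↔ x ∈ A)
    (hQA : ∀ q ∈ Q, (∀ x, q x ∈ A ↔ x ∈ A) ∨ (∀ x, q x ∈ A ↔ x ∉ A))
    (h g g' : Equiv.Perm α) (hg : g ∈ K) (hg' : g' ∈ K)
    (h₁ : ∀ x ∈ A, h x = g x) (h₂ : ∀ x ∉ A, h x = g' x) : h ∈ Q := by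
  let N : Subgroup (Equiv.Perm α) :=
    { carrier := {h | ∃ g ∈ K, ∃ g' ∈ K, (∀ x ∈ A, h x = g x) ∧ ∀ x ∉ A, h x = g' x}
      one_mem' := ⟨1, K.one_mem, 1, K.one_mem, by simp, by simp⟩
      mul_mem' := by
        rintro a b ⟨g, hg, g', hg', ha, ha'⟩ ⟨f, hf, f', hf', hb, hb'⟩
        refine ⟨g * f, K.mul_mem hg hf, g' * f', K.mul_mem hg' hf', fun x hx => ?_, fun x hx => ?_⟩
        · rw [Equiv.Perm.mul_apply, Equiv.Perm.mul_apply, hb x hx, ha _ ((hA f hf x).2 hx)]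
        · rw [Equiv.Perm.mul_apply, Equiv.Perm.mul_apply, hb' x hx,
            ha' _ (fun h => hx ((hA f' hf' x).1 h))]
      inv_mem' := by
        rintro a ⟨g, hg, g', hg', ha, ha'⟩
        refine ⟨g⁻¹, K.inv_mem hg, g'⁻¹, K.inv_mem hg', fun x hx => ?_, fun x hx => ?_⟩
        · rw [Equiv.Perm.inv_eq_iff_eq, ha _ ((hA _ (K.inv_mem hg) x).2 hx)]; simp
        · rw [Equiv.Perm.inv_eq_iff_eq, ha' _ (fun h => hx ((hA _ (K.inv_mem hg') x).1 h))]; simp }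
  have hN : IsPGroup 2 N := by
    rintro ⟨a, g, hg, g', hg', ha, ha'⟩
    obtain ⟨i, hi⟩ := Q.isPGroup' ⟨g, hKQ g hg⟩
    obtain ⟨j, hj⟩ := Q.isPGroup' ⟨g', hKQ g' hg'⟩
    rw [Subtype.ext_iff] at hi hj
    simp only [SubmonoidClass.mk_pow, OneMemClass.coe_one] at hi hj
    have key : ∀ m : ℕ, (∀ x ∈ A, (a ^ m) x = (g ^ m) x) ∧ ∀ x ∉ A, (a ^ m) x = (g' ^ m) x := by
      intro m
      induction m with
      | zero => simp
      | succ m ih =>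
        refine ⟨fun x hx => ?_, fun x hx => ?_⟩
        · rw [pow_succ', pow_succ', Equiv.Perm.mul_apply, Equiv.Perm.mul_apply, ih.1 x hx,
            ha _ ((hA _ (K.pow_mem hg m) x).2 hx)]
        · rw [pow_succ', pow_succ', Equiv.Perm.mul_apply, Equiv.Perm.mul_apply, ih.2 x hx,
            ha' _ (fun h => hx ((hA _ (K.pow_mem hg' m) x).1 h))]
    refine ⟨i + j, Subtype.ext (Equiv.ext fun x => ?_)⟩
    change (a ^ 2 ^ (i + j)) x = (1 : Equiv.Perm α) x
    by_cases hx : x ∈ A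
    · rw [(key _).1 x hx, pow_add, pow_mul, hi, one_pow]
    · rw [(key _).2 x hx, pow_add, mul_comm, pow_mul, hj, one_pow]
  have hconj : ∀ q ∈ Q, ∀ n ∈ N, q * n * q⁻¹ ∈ N := by
    rintro q hq n ⟨g, hg, g', hg', hn, hn'⟩
    have hq' : ∀ x, q (q⁻¹ x) = x := by simp
    rcases hQA q hq with h | h
    · refine ⟨_, hnorm q hq g hg, _, hnorm q hq g' hg', fun x hx => ?_, fun x hx => ?_⟩
      · simp only [Equiv.Perm.mul_apply]
        rw [hn]
        rwa [← h, hq']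
      · simp only [Equiv.Perm.mul_apply]
        rw [hn']
        rwa [← h, hq']
    · refine ⟨_, hnorm q hq g' hg', _, hnorm q hq g hg, fun x hx => ?_, fun x hx => ?_⟩
      · simp only [Equiv.Perm.mul_apply]
        rw [hn']
        rwa [← h, hq']
      · simp only [Equiv.Perm.mul_apply]
        rw [hn]
        rwa [← not_not (a := q⁻¹ x ∈ A), ← h, hq']
  have hle : (Q : Subgroup (Equiv.Perm α)) ≤ Subgroup.normalizer (N : Set (Equiv.Perm α)) := by
    intro q hq
    rw [Subgroup.mem_normalizer_iff]
    refine fun n => ⟨hconj q hq n, fun hn => ?_⟩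
    have := hconj q⁻¹ (inv_mem hq) _ hn
    simpa [mul_assoc] using this
  have hsup := Q.isPGroup'.to_sup_of_normal_right' hN hle
  have := Q.is_maximal' hsup le_sup_left
  have hNQ : N ≤ (Q : Subgroup (Equiv.Perm α)) := this ▸ le_sup_right
  exact hNQ ⟨g, hg, g', hg', h₁, h₂⟩

theorem exists_perm_agree {α : Type*} (A : Set α) (g g' : Equiv.Perm α)
    (hg : ∀ x, g x ∈ A ↔ x ∈ A) (hg' : ∀ x, g' x ∈ A ↔ x ∈ A) :
    ∃ h : Equiv.Perm α, (∀ x ∈ A, h x = g x) ∧ ∀ x ∉ A, h x = g' x := by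
  classical
  refine ⟨Equiv.Perm.subtypeCongr (p := (· ∈ A)) (g.subtypePerm hg)
    (g'.subtypePerm fun x => not_congr (hg' x)), fun x hx => ?_, fun x hx => ?_⟩
  · rw [Equiv.Perm.subtypeCongr.left_apply _ _ hx]; rfl
  · rw [Equiv.Perm.subtypeCongr.right_apply _ _ hx]; rfl

/-- A Sylow `2`-subgroup of a symmetric group is transitive on the product of two distinct
orbits. -/
theorem sylow_transitive_pair {α : Type*} [Finite α] (Q : Sylow 2 (Equiv.Perm α))
    {x x' y y' : α} (hxy : y ∉ MulAction.orbit Q x) (hx : x' ∈ MulAction.orbit Q x)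
    (hy : y' ∈ MulAction.orbit Q y) : ∃ g ∈ Q, g x = x' ∧ g y = y' := by
  obtain ⟨g, rfl⟩ := hx
  obtain ⟨g', rfl⟩ := hy
  have hinv : ∀ q ∈ Q, ∀ z, q z ∈ MulAction.orbit Q x ↔ z ∈ MulAction.orbit Q x := by
    intro q hq z
    rw [← MulAction.orbit_eq_iff, ← MulAction.orbit_eq_iff]
    exact (MulAction.orbit_smul (⟨q, hq⟩ : Q) z).congr_left
  obtain ⟨h, h₁, h₂⟩ := exists_perm_agree (MulAction.orbit Q x) g g' (hinv _ g.2) (hinv _ g'.2)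
  refine ⟨h, mem_sylow_of_agree Q Q (fun _ h => h)
    (fun q hq g hg => mul_mem (mul_mem hq hg) (inv_mem hq)) (MulAction.orbit Q x) hinv
    (fun q hq => Or.inl (hinv q hq)) h g g' g.2 g'.2 h₁ h₂, ?_, ?_⟩
  · rw [h₁ x (MulAction.mem_orbit_self x)]; rfl
  · rw [h₂ y hxy]; rfl

/-- Orbits of a Sylow `2`-subgroup of a symmetric group of degree `n` are divisible by
the `2`-part of `n`. -/
theorem sylow_orbit_dvd {α : Type*} [Fintype α] (Q : Sylow 2 (Equiv.Perm α)) (x : α) :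
    2 ^ padicValNat 2 (Fintype.card α) ∣ Nat.card (MulAction.orbit Q x) := by
  classical
  have : Nonempty α := ⟨x⟩
  obtain ⟨a, ha⟩ := Q.isPGroup'.card_orbit x
  obtain ⟨b, hb⟩ := (IsPGroup.iff_card (G := MulAction.stabilizer Q x) (p := 2)).1
    (Q.isPGroup'.to_subgroup _)
  have hQ := Q.card_eq_multiplicity
  rw [Nat.card_perm, Nat.card_eq_fintype_card (α := α)] at hQ
  have hsum : a + b = (Fintype.card α).factorial.factorization 2 := by
    have h := MulAction.card_orbit_mul_card_stabilizer_eq_card_group Q x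
    simp only [← Nat.card_eq_fintype_card] at h
    rw [ha, hb, hQ, ← pow_add] at h
    exact Nat.pow_right_injective le_rfl h
  have hfull := MulAction.card_orbit_mul_card_stabilizer_eq_card_group (Equiv.Perm α) x
  simp only [← Nat.card_eq_fintype_card] at hfull
  rw [MulAction.orbit_eq_univ, Nat.card_perm, Nat.card_univ] at hfull
  simp only [Nat.card_eq_fintype_card (α := α)] at hfull
  have hdvd : 2 ^ b ∣ Nat.card (MulAction.stabilizer (Equiv.Perm α) x) := by
    rw [← hb]
    refine Subgroup.card_dvd_of_injective
      (((Q : Subgroup (Equiv.Perm α)).subtype.comp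
        (MulAction.stabilizer Q x).subtype).codRestrict
        (MulAction.stabilizer (Equiv.Perm α) x) (fun g => g.2)) ?_
    intro g g' h
    have := congrArg Subtype.val h
    exact Subtype.ext (Subtype.ext this)
  have hm0 : Nat.card (MulAction.stabilizer (Equiv.Perm α) x) ≠ 0 := Nat.card_pos.ne'
  have hble : b ≤ (Nat.card (MulAction.stabilizer (Equiv.Perm α) x)).factorization 2 :=
    (Nat.prime_two.pow_dvd_iff_le_factorization hm0).1 hdvd
  rw [← hfull, Nat.factorization_mul Fintype.card_ne_zero hm0, Finsupp.add_apply,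
    Nat.factorization_def _ Nat.prime_two] at hsum
  rw [ha]
  exact pow_dvd_pow 2 (by omega)

/-- The action of a Sylow `2`-subgroup of the symmetric group of degree `2 ^ (t + 1)` preserves
a partition into two halves, and the setwise stabilizer of a half is transitive on pairs of points
from the two halves. -/
theorem exists_halves {α : Type*} [Fintype α] [DecidableEq α] (Q : Sylow 2 (Equiv.Perm α)) (t : ℕ)
    (ht : Fintype.card α = 2 ^ (t + 1)) :
    ∃ (A : Finset α) (K : Subgroup (Equiv.Perm α)), (∀ g ∈ K, g ∈ Q) ∧
      (∀ g ∈ K, ∀ x, g x ∈ A ↔ x ∈ A) ∧ (∀ g ∈ Q, g ∉ K → ∀ x, g x ∈ A ↔ x ∉ A) ∧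
      (∃ τ ∈ Q, τ ∉ K) ∧
      (∀ x ∈ A, ∀ x' ∈ A, ∀ y ∉ A, ∀ y' ∉ A, ∃ g ∈ K, g x = x' ∧ g y = y') ∧
      A.card = 2 ^ t ∧ Aᶜ.card = 2 ^ t := by
  classical
  have hpos : 0 < Fintype.card α := by rw [ht]; positivity
  obtain ⟨x₀⟩ := Fintype.card_pos_iff.1 hpos
  have htrans : ∀ y, y ∈ MulAction.orbit Q x₀ := by
    have h := sylow_orbit_dvd Q x₀
    rw [ht, padicValNat.prime_pow, ← ht] at h
    have : Nonempty (MulAction.orbit Q x₀) := ⟨⟨x₀, MulAction.mem_orbit_self x₀⟩⟩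
    have h2 := Nat.le_of_dvd Nat.card_pos h
    rw [Nat.card_eq_fintype_card] at h2
    have : (MulAction.orbit Q x₀) = Set.univ := by
      rw [← Set.toFinset_inj, Set.toFinset_univ, ← Finset.card_eq_iff_eq_univ, Set.toFinset_card]
      exact le_antisymm (Fintype.card_le_of_injective _ Subtype.val_injective) h2
    simp [this]
  have horb : Nat.card (MulAction.orbit Q x₀) = 2 ^ (t + 1) := by
    have : (MulAction.orbit Q x₀) = Set.univ := Set.eq_univ_of_forall htrans
    rw [this, Nat.card_univ, Nat.card_eq_fintype_card, ht]
  obtain ⟨b, hb⟩ := (IsPGroup.iff_card (G := MulAction.stabilizer Q x₀) (p := 2)).1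
    (Q.isPGroup'.to_subgroup _)
  have hQ : Nat.card Q = 2 ^ (t + b) * 2 := by
    have h := MulAction.card_orbit_mul_card_stabilizer_eq_card_group Q x₀
    simp only [← Nat.card_eq_fintype_card] at h
    rw [horb, hb] at h
    rw [← h]; ring
  obtain ⟨K', hK', hstab⟩ := Sylow.exists_subgroup_card_pow_prime_le (G := Q) 2 (m := t + b)
    ⟨2, hQ⟩ _ hb (by omega)
  have hind : K'.index = 2 := by
    have h := K'.card_mul_index
    rw [hK', hQ] at h
    exact Nat.eq_of_mul_eq_mul_left (by positivity) h
  have hmulmem : ∀ {a b : Q}, a * b ∈ K' ↔ (a ∈ K' ↔ b ∈ K') :=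
    Subgroup.mul_mem_iff_of_index_two hind
  let K := K'.map (Q : Subgroup (Equiv.Perm α)).subtype
  have hmemK : ∀ q : Q, (q : Equiv.Perm α) ∈ K ↔ q ∈ K' := fun q =>
    ⟨fun ⟨r, hr, hrq⟩ => by rwa [← Subtype.ext hrq], fun h => ⟨q, h, rfl⟩⟩
  have hKQ : ∀ g ∈ K, g ∈ Q := by
    rintro _ ⟨r, -, rfl⟩
    exact r.2
  let A : Finset α := Finset.univ.filter fun x => ∃ g ∈ K, g x₀ = x
  have hA₀ : ∀ q : Q, (q : Equiv.Perm α) x₀ ∈ A ↔ q ∈ K' := by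
    intro q
    simp only [A, Finset.mem_filter, Finset.mem_univ, true_and]
    refine ⟨?_, fun h => ⟨q, (hmemK q).2 h, rfl⟩⟩
    rintro ⟨_, ⟨r, hr, rfl⟩, h⟩
    have h1 : r⁻¹ * q ∈ K' := by
      apply hstab
      rw [MulAction.mem_stabilizer_iff]
      change (r : Equiv.Perm α)⁻¹ ((q : Equiv.Perm α) x₀) = x₀
      rw [← h]; simp
    exact (hmulmem.1 h1).1 (K'.inv_mem hr)
  have hswap : ∀ q : Q, ∀ x, (q : Equiv.Perm α) x ∈ A ↔ (q ∈ K' ↔ x ∈ A) := by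
    intro q x
    obtain ⟨r, rfl⟩ := htrans x
    have := hA₀ (q * r)
    rw [hmulmem, ← hA₀ r] at this
    exact this
  have hKA : ∀ g ∈ K, ∀ x, g x ∈ A ↔ x ∈ A := by
    rintro _ ⟨r, hr, rfl⟩ x
    have hr' : r ∈ K' := hr
    simpa [hr'] using hswap r x
  have hQA : ∀ g ∈ Q, g ∉ K → ∀ x, g x ∈ A ↔ x ∉ A := by
    intro g hg hgK x
    have := hswap ⟨g, hg⟩ x
    rw [← hmemK] at this
    simpa [hgK] using this
  have hnorm : ∀ q ∈ Q, ∀ g ∈ K, q * g * q⁻¹ ∈ K := by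
    rintro q hq _ ⟨r, hr, rfl⟩
    have := (Subgroup.normal_of_index_eq_two hind).conj_mem r hr ⟨q, hq⟩
    exact (hmemK _).2 this
  obtain ⟨τ, hτ⟩ : ∃ τ : Q, τ ∉ K' := by
    by_contra! h
    rw [(Subgroup.eq_top_iff' K').2 h, Subgroup.index_top] at hind
    omega
  have hτK : (τ : Equiv.Perm α) ∉ K := fun h => hτ ((hmemK _).1 h)
  have hK₀ : ∀ x ∈ A, ∃ g ∈ K, g x₀ = x := fun x hx => (Finset.mem_filter.1 hx).2
  have hx₀ : x₀ ∈ A := (hA₀ 1).2 K'.one_mem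
  have hK₁ : ∀ x ∉ A, ∃ g ∈ K, g ((τ : Equiv.Perm α) x₀) = x := by
    intro x hx
    have h : (τ : Equiv.Perm α)⁻¹ x ∈ A := by
      have h1 := hQA τ⁻¹ (inv_mem τ.2) (fun h => hτK (by simpa using K.inv_mem h)) x
      exact h1.2 hx
    obtain ⟨g, hg, hgx⟩ := hK₀ _ h
    refine ⟨_, hnorm τ τ.2 g hg, ?_⟩
    simp [hgx]
  have hcard : A.card = Aᶜ.card := by
    refine Finset.card_bij (fun x _ => (τ : Equiv.Perm α) x) (fun x hx => ?_)
      (fun x _ y _ h => (τ : Equiv.Perm α).injective h)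
      (fun y hy => ⟨(τ : Equiv.Perm α)⁻¹ y, ?_, by simp⟩)
    · rw [Finset.mem_compl, hQA τ τ.2 hτK]; simpa using hx
    · rw [Finset.mem_compl] at hy
      by_contra h
      exact hy (by simpa using (hQA τ τ.2 hτK _).2 h)
  have hcard2 : A.card + Aᶜ.card = 2 ^ (t + 1) := by rw [Finset.card_add_card_compl, ht]
  refine ⟨A, K, hKQ, hKA, hQA, ⟨τ, τ.2, hτK⟩, ?_, by omega, by omega⟩
  intro x hx x' hx' y hy y' hy'
  obtain ⟨a, ha, rfl⟩ := hK₀ x hx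
  obtain ⟨a', ha', rfl⟩ := hK₀ x' hx'
  obtain ⟨b, hb, rfl⟩ := hK₁ y hy
  obtain ⟨b', hb', rfl⟩ := hK₁ y' hy'
  have h₁ := K.mul_mem ha' (K.inv_mem ha)
  have h₂ := K.mul_mem hb' (K.inv_mem hb)
  obtain ⟨h, hh₁, hh₂⟩ := exists_perm_agree (A : Set α) _ _
    (fun z => hKA _ h₁ z) (fun z => hKA _ h₂ z)
  have hhQ : h ∈ Q := mem_sylow_of_agree Q K hKQ hnorm (A : Set α) hKA
    (fun q hq => by
      by_cases hqK : q ∈ K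
      · exact Or.inl (hKA q hqK)
      · exact Or.inr (hQA q hq hqK)) h _ _ h₁ h₂ hh₁ hh₂
  refine ⟨h, ?_, ?_, ?_⟩
  · by_contra hhK
    have h3 := hQA h hhQ hhK (a x₀)
    rw [hh₁ _ hx] at h3
    simp [hx, hx'] at h3
  · rw [hh₁ _ hx]; simp
  · rw [hh₂ _ hy]; simp

theorem perm_inv_apply_self {α : Type*} (g : Equiv.Perm α) (x : α) : g⁻¹ (g x) = x :=
  g.symm_apply_apply x

/-- The action of a field automorphism and a permutation on tuples of field elements. -/
def twist {k L α : Type*} [Field k] [Field L] [Algebra k L] (γ : L ≃ₐ[k] L) (g : Equiv.Perm α)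
    (w : α → L) : α → L := fun x => γ (w (g⁻¹ x))

/-- The positions at which a tuple of `2 ^ (m + 1)`-th roots of unity is a primitive root. -/
noncomputable def oddSet {L α : Type*} [Field L] [Fintype α] (m : ℕ) (w : α → L) : Finset α :=
  open Classical in Finset.univ.filter fun x => w x ^ 2 ^ m = -1

theorem mem_oddSet {L α : Type*} [Field L] [Fintype α] {m : ℕ} {w : α → L} {x : α} :
    x ∈ oddSet m w ↔ w x ^ 2 ^ m = -1 := by
  simp [oddSet]

theorem prod_pow_eq_neg_one_pow {L α : Type*} [Field L] [Fintype α] [DecidableEq α] {m : ℕ}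
    {w : α → L} (hw : ∀ x, w x ^ 2 ^ (m + 1) = 1) (A : Finset α) :
    ∏ x ∈ A, w x ^ 2 ^ m = (-1) ^ (A ∩ oddSet m w).card := by
  have h : ∀ x ∈ A, w x ^ 2 ^ m = if x ∈ oddSet m w then -1 else 1 := by
    intro x _
    split_ifs with hx
    · exact mem_oddSet.1 hx
    · have h1 := hw x
      rw [pow_succ, pow_mul, sq_eq_one_iff] at h1
      exact h1.resolve_right (fun h => hx (mem_oddSet.2 h))
  rw [Finset.prod_congr rfl h, Finset.prod_ite, Finset.prod_const, Finset.prod_const_one, mul_one,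
    Finset.filter_mem_eq_inter]

theorem prod_pow_eq_neg_one_iff {L α : Type*} [Field L] (h2 : (-1 : L) ≠ 1) [Fintype α]
    [DecidableEq α] {m : ℕ} {w : α → L} (hw : ∀ x, w x ^ 2 ^ (m + 1) = 1) (A : Finset α) :
    ∏ x ∈ A, w x ^ 2 ^ m = -1 ↔ Odd (A ∩ oddSet m w).card := by
  rw [prod_pow_eq_neg_one_pow hw]
  rcases Nat.even_or_odd (A ∩ oddSet m w).card with h | h
  · rw [h.neg_one_pow, ← Nat.not_even_iff_odd]
    simp [h, h2.symm]
  · rw [h.neg_one_pow]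
    simp [h]

theorem apply_mem_oddSet_twist {k L α : Type*} [Field k] [Field L] [Algebra k L] [Fintype α]
    {m : ℕ} {w : α → L} (γ : L ≃ₐ[k] L) (g : Equiv.Perm α) (x : α) :
    g x ∈ oddSet m (twist γ g w) ↔ x ∈ oddSet m w := by
  rw [mem_oddSet, mem_oddSet, twist, ← map_pow, perm_inv_apply_self]
  exact ⟨fun h => γ.injective (by rw [h, map_neg, map_one]), fun h => by rw [h, map_neg, map_one]⟩

theorem card_inter_oddSet_twist {k L α : Type*} [Field k] [Field L] [Algebra k L] [Fintype α]
    [DecidableEq α] {m : ℕ} {w : α → L} (γ : L ≃ₐ[k] L) (g : Equiv.Perm α) (A : Finset α)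
    (hA : ∀ x, g x ∈ A ↔ x ∈ A) :
    (A ∩ oddSet m (twist γ g w)).card = (A ∩ oddSet m w).card := by
  symm
  refine Finset.card_bij (fun x _ => g x) (fun x hx => ?_) (fun x _ y _ h => g.injective h)
    (fun y hy => ⟨g⁻¹ y, ?_, by simp⟩)
  · rw [Finset.mem_inter] at hx ⊢
    rwa [hA, apply_mem_oddSet_twist]
  · rw [Finset.mem_inter] at hy ⊢
    rw [← hA, ← apply_mem_oddSet_twist γ g]
    simpa using hy

theorem exists_fixed_of_odd {α : Type*} [Finite α] (H : Subgroup (Equiv.Perm α))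
    (hH : IsPGroup 2 H) (S : Finset α) (hS : Odd S.card) (hinv : ∀ h ∈ H, ∀ x ∈ S, h x ∈ S) :
    ∃ x ∈ S, ∀ h ∈ H, h x = x := by
  let T : SubMulAction H α := ⟨(S : Set α), fun {c x} hx => hinv c c.2 x hx⟩
  have hT : ¬ 2 ∣ Nat.card T := by
    have : Nat.card T = S.card := by
      rw [← Set.ncard_coe_finset]; rfl
    rw [this, ← even_iff_two_dvd]
    exact Nat.not_even_iff_odd.2 hS
  obtain ⟨x, hx⟩ := hH.nonempty_fixed_point_of_prime_not_dvd_card T hT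
  exact ⟨x, x.2, fun h hh => congrArg Subtype.val (hx ⟨h, hh⟩)⟩

theorem twist_eq_twist {k L α : Type*} [Field k] [Field L] [Algebra k L] {γ γ' : L ≃ₐ[k] L}
    {g g' : Equiv.Perm α} {w : α → L} (h : twist γ g w = twist γ' g' w) :
    twist (γ'⁻¹ * γ) (g'⁻¹ * g) w = w := by
  funext x
  have := congrFun h (g' x)
  simp only [twist, perm_inv_apply_self] at this
  simp only [twist, mul_inv_rev, inv_inv, Equiv.Perm.mul_apply, AlgEquiv.mul_apply, this]
  exact γ'.symm_apply_apply _

/-- The orbit of a tuple with an odd number of primitive roots in `A` and in `B`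
is at least as large as the product of `A`, `B` and the Galois group. -/
theorem card_weight_orbit {k L α : Type*} [Field k] [Field L] [Algebra k L]
    [FiniteDimensional k L] [Fintype α] [DecidableEq α] {m : ℕ}
    (hgen : ∀ ζ : L, ζ ^ 2 ^ m = -1 → ∀ γ : L ≃ₐ[k] L, γ ζ = ζ → γ = 1)
    (K : Subgroup (Equiv.Perm α)) (hK : IsPGroup 2 K) (A B : Finset α)
    (hA : ∀ g ∈ K, ∀ x, g x ∈ A ↔ x ∈ A) (hB : ∀ g ∈ K, ∀ x, g x ∈ B ↔ x ∈ B)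
    (htrans : ∀ x ∈ A, ∀ x' ∈ A, ∀ y ∈ B, ∀ y' ∈ B, ∃ g ∈ K, g x = x' ∧ g y = y')
    (w : α → L) (hwA : Odd (A ∩ oddSet m w).card) (hwB : Odd (B ∩ oddSet m w).card)
    (Λ : Finset (α → L)) (hΛ : ∀ γ : L ≃ₐ[k] L, ∀ g ∈ K, twist γ g w ∈ Λ) :
    Nat.card (L ≃ₐ[k] L) * (A.card * B.card) ≤ Λ.card := by
  classical
  let H : Subgroup (Equiv.Perm α) :=
    { carrier := {g | g ∈ K ∧ ∃ γ : L ≃ₐ[k] L, twist γ g w = w}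
      one_mem' := ⟨K.one_mem, 1, by funext x; simp [twist]⟩
      mul_mem' := by
        rintro a b ⟨ha, γ, hγ⟩ ⟨hb, δ, hδ⟩
        refine ⟨K.mul_mem ha hb, γ * δ, ?_⟩
        funext x
        have h1 := congrFun hδ (a⁻¹ x)
        have h2 := congrFun hγ x
        simp only [twist] at h1 h2
        simp only [twist, mul_inv_rev, Equiv.Perm.mul_apply, AlgEquiv.mul_apply, h1, h2]
      inv_mem' := by
        rintro a ⟨ha, γ, hγ⟩
        refine ⟨K.inv_mem ha, γ⁻¹, ?_⟩
        funext x
        have h2 := congrFun hγ (a x)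
        simp only [twist, perm_inv_apply_self] at h2
        simp only [twist, inv_inv, ← h2]
        exact γ.symm_apply_apply _ }
  have hHK : H ≤ K := fun g hg => hg.1
  have hH : IsPGroup 2 H := hK.to_le hHK
  have hHD : ∀ h ∈ H, ∀ x, h x ∈ oddSet m w ↔ x ∈ oddSet m w := by
    rintro h ⟨_, γ, hγ⟩ x
    rw [← apply_mem_oddSet_twist γ h x, hγ]
  obtain ⟨x, hx, hxfix⟩ := exists_fixed_of_odd H hH _ hwA (fun h hh x hx => by
    rw [Finset.mem_inter] at hx ⊢
    exact ⟨(hA h hh.1 x).2 hx.1, (hHD h hh x).2 hx.2⟩)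
  obtain ⟨y, hy, hyfix⟩ := exists_fixed_of_odd H hH _ hwB (fun h hh x hx => by
    rw [Finset.mem_inter] at hx ⊢
    exact ⟨(hB h hh.1 x).2 hx.1, (hHD h hh x).2 hx.2⟩)
  rw [Finset.mem_inter] at hx hy
  choose! G hG using fun x' (hx' : x' ∈ A) y' (hy' : y' ∈ B) => htrans x hx.1 x' hx' y hy.1 y' hy'
  have hcard : Nat.card (L ≃ₐ[k] L) * (A.card * B.card)
      = ((Finset.univ : Finset (L ≃ₐ[k] L)) ×ˢ (A ×ˢ B)).card := by
    rw [Finset.card_product, Finset.card_product, Finset.card_univ, Nat.card_eq_fintype_card]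
  rw [hcard]
  refine Finset.card_le_card_of_injOn (fun c => twist c.1 (G c.2.1 c.2.2) w) ?_ ?_
  · rintro ⟨γ, x', y'⟩ hc
    simp only [Finset.coe_product, Finset.coe_univ, Set.mem_prod, Finset.mem_coe] at hc
    exact hΛ γ _ (hG x' hc.2.1 y' hc.2.2).1
  · rintro ⟨γ, x', y'⟩ hc ⟨γ', x'', y''⟩ hc' heq
    simp only [Finset.coe_product, Finset.coe_univ, Set.mem_prod, Finset.mem_coe] at hc hc'
    obtain ⟨h1, h2, h3⟩ := hG x' hc.2.1 y' hc.2.2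
    obtain ⟨h1', h2', h3'⟩ := hG x'' hc'.2.1 y'' hc'.2.2
    have hfix := twist_eq_twist heq
    have hmem : (G x'' y'')⁻¹ * G x' y' ∈ H := ⟨K.mul_mem (K.inv_mem h1') h1, _, hfix⟩
    have hxx := hxfix _ hmem
    have hyy := hyfix _ hmem
    have hγ : γ'⁻¹ * γ = 1 := by
      refine hgen (w x) (mem_oddSet.1 hx.2) _ ?_
      have := congrFun hfix x
      rwa [twist, Equiv.Perm.inv_eq_iff_eq.2 hxx.symm] at this
    rw [Equiv.Perm.mul_apply, Equiv.Perm.inv_eq_iff_eq, h2, h2'] at hxx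
    rw [Equiv.Perm.mul_apply, Equiv.Perm.inv_eq_iff_eq, h3, h3'] at hyy
    rw [inv_mul_eq_one] at hγ
    simp [hγ, hxx, hyy]

/-- The properties of the set of weights of a faithful representation which are used
for bounding its size from below. -/
structure IsWeightSet (k : Type*) {L α : Type*} [Field k] [Field L] [Algebra k L] [Fintype α]
    (m : ℕ) (Q : Subgroup (Equiv.Perm α)) (Λ : Finset (α → L)) : Prop where
  pow_eq_one : ∀ w ∈ Λ, ∀ x, w x ^ 2 ^ (m + 1) = 1
  prod_eq_one : ∀ w ∈ Λ, ∏ x, w x = 1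
  twist_mem : ∀ w ∈ Λ, ∀ γ : L ≃ₐ[k] L, ∀ g ∈ Q, twist γ g w ∈ Λ
  separates : ∀ A : Finset α, A.Nonempty → A ≠ Finset.univ → ∃ w ∈ Λ, ∏ x ∈ A, w x ^ 2 ^ m = -1

theorem IsWeightSet.even_card_oddSet {k L α : Type*} [Field k] [Field L] [Algebra k L] [Fintype α]
    [DecidableEq α] {m : ℕ} {Q : Subgroup (Equiv.Perm α)} {Λ : Finset (α → L)}
    (h2 : (-1 : L) ≠ 1) (h : IsWeightSet k m Q Λ) {w : α → L} (hw : w ∈ Λ) :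
    Even (oddSet m w).card := by
  by_contra hodd
  have h1 := (prod_pow_eq_neg_one_iff h2 (h.pow_eq_one w hw) Finset.univ).2
    (by rw [Finset.univ_inter]; exact Nat.not_even_iff_odd.1 hodd)
  rw [Finset.prod_pow, h.prod_eq_one w hw, one_pow] at h1
  exact h2 h1.symm

/-- If no nonzero linear functional vanishes on a finite set `V` of vectors over `ZMod 2`, there
are distinct vectors `f i ∈ V` with `f i i = 1`. -/
theorem exists_injective_of_separating {ι : Type*} [Fintype ι] [DecidableEq ι]
    (V : Finset (ι → ZMod 2))
    (hV : ∀ J : Finset ι, J.Nonempty → ∃ v ∈ V, ∑ j ∈ J, v j = 1) :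
    ∃ f : ι → ι → ZMod 2, Function.Injective f ∧ ∀ i, f i ∈ V ∧ f i i = 1 := by
  let T : ι → Finset (ι → ZMod 2) := fun i => V.filter fun v => v i = 1
  obtain ⟨f, hf, hf'⟩ := (Finset.all_card_le_biUnion_card_iff_exists_injective T).1 (by
      intro I
      set M := I.biUnion T with hM
      let Φ : (I → ZMod 2) →+ (M → ZMod 2) :=
        { toFun := fun c v => ∑ i, c i * v.1 i
          map_zero' := by funext v; simp
          map_add' := by intro c d; funext v; simp [add_mul, Finset.sum_add_distrib] }
      have hΦ : Function.Injective Φ := by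
        rw [injective_iff_map_eq_zero]
        intro c hc
        by_contra hne
        obtain ⟨i₀, hi₀⟩ := Function.ne_iff.1 hne
        have h01 : ∀ a : ZMod 2, a ≠ 0 → a = 1 := by decide
        let J : Finset ι := (Finset.univ.filter fun i : I => c i = 1).map
          (Function.Embedding.subtype _)
        obtain ⟨v, hv, hsum⟩ := hV J ⟨i₀, by
          simp only [J, Finset.mem_map, Finset.mem_filter, Finset.mem_univ, true_and]
          exact ⟨i₀, h01 _ hi₀, rfl⟩⟩
        have hsum' : ∑ i, c i * v i = 1 := by
          rw [← hsum, Finset.sum_map, Finset.sum_filter]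
          refine Finset.sum_congr rfl fun i _ => ?_
          split_ifs with h
          · simp [h]
          · have : c i = 0 := by by_contra h'; exact h (h01 _ h')
            simp [this]
        have hvM : v ∈ M := by
          rw [hM, Finset.mem_biUnion]
          obtain ⟨j, hj, hj'⟩ := Finset.exists_ne_zero_of_sum_ne_zero
            (hsum.trans_ne one_ne_zero)
          obtain ⟨a, -, rfl⟩ := Finset.mem_map.1 hj
          exact ⟨a, a.2, Finset.mem_filter.2 ⟨hv, h01 _ hj'⟩⟩
        have := congrFun hc ⟨v, hvM⟩
        simp only [Φ, AddMonoidHom.coe_mk, ZeroHom.coe_mk, Pi.zero_apply] at this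
        rw [hsum'] at this
        exact one_ne_zero this
      have h := Fintype.card_le_of_injective Φ hΦ
      rw [Fintype.card_fun, Fintype.card_fun, ZMod.card, Fintype.card_coe, Fintype.card_coe] at h
      exact (Nat.pow_le_pow_iff_right (by norm_num)).1 h)
  exact ⟨f, hf, fun i => Finset.mem_filter.1 (hf' i)⟩

/-- Lower bound for the number of weights in terms of an orbit of minimal size. -/
theorem card_weights_ge_of_orbit {k L α : Type*} [Field k] [Field L] [Algebra k L]
    [FiniteDimensional k L] [Fintype α] [DecidableEq α] (h2 : (-1 : L) ≠ 1) {m : ℕ}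
    (hgen : ∀ ζ : L, ζ ^ 2 ^ m = -1 → ∀ γ : L ≃ₐ[k] L, γ ζ = ζ → γ = 1)
    (Q : Sylow 2 (Equiv.Perm α)) (Λ : Finset (α → L)) (hΛ : IsWeightSet k m Q Λ) (x₀ : α)
    (hmin : ∀ x : α, Nat.card (MulAction.orbit Q x₀) ≤ Nat.card (MulAction.orbit Q x)) :
    Nat.card (L ≃ₐ[k] L) * (Nat.card (MulAction.orbit Q x₀) *
      (Fintype.card α - Nat.card (MulAction.orbit Q x₀))) ≤ Λ.card := by
  classical
  let Ω := MulAction.orbitRel.Quotient Q α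
  let mk : α → Ω := fun x => Quotient.mk'' x
  have hmk : ∀ x y, mk x = mk y ↔ x ∈ MulAction.orbit Q y := fun x y =>
    Quotient.eq''.trans (MulAction.orbitRel_apply (G := Q) (α := α))
  let O : Ω → Finset α := fun ω => Finset.univ.filter fun x => mk x = ω
  have hO : ∀ ω x, x ∈ O ω ↔ mk x = ω := fun ω x => by simp [O]
  have hOinv : ∀ ω, ∀ g ∈ Q, ∀ x, g x ∈ O ω ↔ x ∈ O ω := by
    intro ω g hg x
    have : mk (g x) = mk x := (hmk _ _).2 ⟨⟨g, hg⟩, rfl⟩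
    rw [hO, hO, this]
  have hcardO : ∀ x, (O (mk x)).card = Nat.card (MulAction.orbit Q x) := by
    intro x
    have : (O (mk x) : Set α) = MulAction.orbit Q x := by
      ext y; rw [Finset.mem_coe, hO, hmk]
    rw [← Set.ncard_coe_finset, this]; rfl
  have hminO : ∀ ω, (O (mk x₀)).card ≤ (O ω).card := by
    intro ω
    obtain ⟨x, rfl⟩ := Quotient.exists_rep ω
    have := hmin x
    rw [← hcardO, ← hcardO] at this
    exact this
  have hdisj : ∀ ω ω', ω ≠ ω' → Disjoint (O ω) (O ω') := by
    intro ω ω' h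
    rw [Finset.disjoint_left]
    intro x hx hx'
    exact h (((hO _ _).1 hx).symm.trans ((hO _ _).1 hx'))
  let ι := {ω : Ω // ω ≠ mk x₀}
  let pv : (α → L) → ι → ZMod 2 := fun w i => ((O i ∩ oddSet m w).card : ZMod 2)
  obtain ⟨f, hf, hf'⟩ := exists_injective_of_separating (Λ.image pv) (by
    intro J hJ
    obtain ⟨w, hw, hwp⟩ := hΛ.separates (J.biUnion fun j => O j)
      (by
        obtain ⟨j, hj⟩ := hJ
        obtain ⟨x, hx⟩ := Quotient.exists_rep j.1
        exact ⟨x, Finset.mem_biUnion.2 ⟨j, hj, (hO _ _).2 hx⟩⟩)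
      (by
        intro h
        have := Finset.mem_univ x₀
        rw [← h, Finset.mem_biUnion] at this
        obtain ⟨j, -, hj⟩ := this
        exact j.2 ((hO _ _).1 hj).symm)
    rw [prod_pow_eq_neg_one_iff h2 (hΛ.pow_eq_one w hw), Finset.biUnion_inter,
      Finset.card_biUnion] at hwp
    · refine ⟨_, Finset.mem_image_of_mem _ hw, ?_⟩
      rw [← ZMod.natCast_eq_one_iff_odd] at hwp
      rw [← hwp]
      push_cast
      rfl
    · intro i _ j _ hij
      exact (hdisj _ _ fun h => hij (Subtype.ext h)).mono Finset.inter_subset_left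
        Finset.inter_subset_left)
  have hfiber : ∀ i : ι, Nat.card (L ≃ₐ[k] L) * ((O i).card * (O (mk x₀)).card)
      ≤ (Λ.filter fun w => pv w = f i).card := by
    intro i
    obtain ⟨w, hw, hwf⟩ := Finset.mem_image.1 (hf' i).1
    have hodd : Odd (O i ∩ oddSet m w).card := by
      rw [← ZMod.natCast_eq_one_iff_odd, ← (hf' i).2, ← hwf]
    obtain ⟨ω, hωi, hω⟩ : ∃ ω, ω ≠ i.1 ∧ Odd (O ω ∩ oddSet m w).card := by
      by_contra! hcon
      have hsum : (oddSet m w).card = ∑ ω, (O ω ∩ oddSet m w).card := by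
        rw [← Finset.card_biUnion, ← Finset.biUnion_inter]
        · congr 1
          ext x
          simp [hO]
        · intro i _ j _ hij
          exact (hdisj _ _ hij).mono Finset.inter_subset_left Finset.inter_subset_left
      have heven := hΛ.even_card_oddSet h2 hw
      rw [hsum, ← Finset.add_sum_erase _ _ (Finset.mem_univ i.1), Nat.even_add] at heven
      refine (Nat.not_even_iff_odd.2 hodd) (heven.2 (Finset.even_sum _ fun ω hω => ?_))
      exact Nat.not_odd_iff_even.1 (hcon ω (Finset.ne_of_mem_erase hω))
    have := card_weight_orbit hgen Q Q.isPGroup' (O i) (O ω) (hOinv _) (hOinv _)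
      (by
        intro x hx x' hx' y hy y' hy'
        rw [hO] at hx hx' hy hy'
        refine sylow_transitive_pair Q ?_ ((hmk _ _).1 (hx'.trans hx.symm))
          ((hmk _ _).1 (hy'.trans hy.symm))
        rw [← hmk, hx, hy]
        exact hωi) w hodd hω (Λ.filter fun w => pv w = f i) (by
        intro γ g hg
        refine Finset.mem_filter.2 ⟨hΛ.twist_mem w hw γ g hg, ?_⟩
        rw [← hwf]
        funext j
        simp only [pv]
        rw [card_inter_oddSet_twist _ _ _ (hOinv _ g hg)])
    exact (Nat.mul_le_mul_left _ (Nat.mul_le_mul_left _ (hminO ω))).trans this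
  have hsumO : ∑ i : ι, (O i).card = Fintype.card α - Nat.card (MulAction.orbit Q x₀) := by
    have h1 : ∑ ω, (O ω).card = Fintype.card α := by
      rw [← Finset.card_univ]
      exact (Finset.card_eq_sum_card_fiberwise (f := mk) (t := Finset.univ) (by simp)).symm
    have h2 : ∑ i : ι, (O i).card = ∑ ω ∈ Finset.univ.erase (mk x₀), (O ω).card :=
      (Finset.sum_subtype (Finset.univ.erase (mk x₀)) (by simp) fun ω => (O ω).card).symm
    rw [h2, ← hcardO, ← h1, ← Finset.add_sum_erase _ _ (Finset.mem_univ (mk x₀)),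
      Nat.add_sub_cancel_left]
  calc Nat.card (L ≃ₐ[k] L) * (Nat.card (MulAction.orbit Q x₀) *
      (Fintype.card α - Nat.card (MulAction.orbit Q x₀)))
      = ∑ i : ι, Nat.card (L ≃ₐ[k] L) * ((O i).card * (O (mk x₀)).card) := by
        rw [← hsumO, ← Finset.mul_sum, ← Finset.sum_mul, hcardO, mul_comm (∑ i : ι, _)]
    _ ≤ ∑ i : ι, (Λ.filter fun w => pv w = f i).card := Finset.sum_le_sum fun i _ => hfiber i
    _ = (Finset.univ.biUnion fun i : ι => Λ.filter fun w => pv w = f i).card := by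
        rw [Finset.card_biUnion]
        intro i _ j _ hij
        rw [Function.onFun, Finset.disjoint_left]
        intro w hw hw'
        exact hij (hf ((Finset.mem_filter.1 hw).2.symm.trans (Finset.mem_filter.1 hw').2))
    _ ≤ Λ.card := Finset.card_le_card (Finset.biUnion_subset.2 fun i _ => Finset.filter_subset _ _)

/-- Lower bounds for the number of weights when the degree is `2 ^ (t + 1)`. -/
theorem card_weights_ge_of_halves {k L α : Type*} [Field k] [Field L] [Algebra k L]
    [FiniteDimensional k L] [Fintype α] [DecidableEq α] (h2 : (-1 : L) ≠ 1) {m : ℕ}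
    (hgen : ∀ ζ : L, ζ ^ 2 ^ m = -1 → ∀ γ : L ≃ₐ[k] L, γ ζ = ζ → γ = 1)
    (Q : Sylow 2 (Equiv.Perm α)) (Λ : Finset (α → L)) (hΛ : IsWeightSet k m Q Λ) (t : ℕ)
    (ht : Fintype.card α = 2 ^ (t + 1)) :
    Nat.card (L ≃ₐ[k] L) * 2 ^ (2 * t) ≤ Λ.card ∧
      ((∀ ζ : L, ζ ^ 2 ^ m = -1 → ∀ γ : L ≃ₐ[k] L, γ ζ ≠ ζ⁻¹) →
        Nat.card (L ≃ₐ[k] L) * 2 ^ (2 * t + 1) ≤ Λ.card) := by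
  classical
  obtain ⟨A, K, hKQ, hKA, hQA, ⟨τ, hτQ, hτK⟩, htrans, hcA, hcB⟩ := exists_halves Q t ht
  have hK : IsPGroup 2 K := Q.isPGroup'.to_le hKQ
  have hKB : ∀ g ∈ K, ∀ x, g x ∈ Aᶜ ↔ x ∈ Aᶜ := by
    intro g hg x
    rw [Finset.mem_compl, Finset.mem_compl, hKA g hg]
  have hne : A.Nonempty := Finset.card_pos.1 (by rw [hcA]; positivity)
  have hne' : A ≠ Finset.univ := by
    rw [Ne, ← Finset.compl_eq_empty_iff, ← Finset.card_eq_zero, hcB]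
    positivity
  obtain ⟨w, hw, hwp⟩ := hΛ.separates A hne hne'
  have hsplit : ∀ w' : α → L, (oddSet m w').card
      = (A ∩ oddSet m w').card + (Aᶜ ∩ oddSet m w').card := by
    intro w'
    rw [← Finset.card_union_of_disjoint, ← Finset.union_inter_distrib_right,
      Finset.union_compl, Finset.univ_inter]
    exact disjoint_compl_right.mono Finset.inter_subset_left Finset.inter_subset_left
  have hbound : ∀ w' ∈ Λ, Odd (A ∩ oddSet m w').card → ∀ Λ' : Finset (α → L),
      (∀ γ : L ≃ₐ[k] L, ∀ g ∈ K, twist γ g w' ∈ Λ') →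
      Nat.card (L ≃ₐ[k] L) * 2 ^ (2 * t) ≤ Λ'.card := by
    intro w' hw' hodd Λ' hΛ'
    have hodd' : Odd (Aᶜ ∩ oddSet m w').card := by
      have := hΛ.even_card_oddSet h2 hw'
      rw [hsplit, Nat.even_add] at this
      rw [← Nat.not_even_iff_odd] at hodd ⊢
      rwa [← this]
    have h := card_weight_orbit hgen K hK A Aᶜ hKA hKB
      (fun x hx x' hx' y hy y' hy' =>
        htrans x hx x' hx' y (Finset.mem_compl.1 hy) y' (Finset.mem_compl.1 hy'))
      w' hodd hodd' Λ' hΛ'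
    rwa [hcA, hcB, ← pow_add, ← two_mul] at h
  have hwodd := (prod_pow_eq_neg_one_iff h2 (hΛ.pow_eq_one w hw) A).1 hwp
  refine ⟨hbound w hw hwodd Λ fun γ g hg => hΛ.twist_mem w hw γ g (hKQ g hg), fun hinv => ?_⟩
  let S : (α → L) → Finset (α → L) := fun w' =>
    Finset.univ.image fun c : (L ≃ₐ[k] L) × K => twist c.1 (c.2 : Equiv.Perm α) w'
  have hS : ∀ w', ∀ γ : L ≃ₐ[k] L, ∀ g ∈ K, twist γ g w' ∈ S w' := fun w' γ g hg =>
    Finset.mem_image.2 ⟨(γ, ⟨g, hg⟩), Finset.mem_univ _, rfl⟩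
  have hSΛ : ∀ w' ∈ Λ, S w' ⊆ Λ := by
    intro w' hw' u hu
    obtain ⟨c, -, rfl⟩ := Finset.mem_image.1 hu
    exact hΛ.twist_mem w' hw' _ _ (hKQ _ c.2.2)
  set w₂ := twist (1 : L ≃ₐ[k] L) τ w with hw₂
  have hw₂Λ : w₂ ∈ Λ := hΛ.twist_mem w hw 1 τ hτQ
  have hw₂odd : Odd (A ∩ oddSet m w₂).card := by
    have hodd' : Odd (Aᶜ ∩ oddSet m w).card := by
      have := hΛ.even_card_oddSet h2 hw
      rw [hsplit, Nat.even_add] at this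
      rw [← Nat.not_even_iff_odd] at hwodd ⊢
      rwa [← this]
    convert hodd' using 1
    symm
    refine Finset.card_bij (fun x _ => τ x) (fun x hx => ?_) (fun x _ y _ h => τ.injective h)
      (fun y hy => ⟨τ⁻¹ y, ?_, by simp⟩)
    · rw [Finset.mem_inter] at hx ⊢
      rwa [hQA τ hτQ hτK, ← Finset.mem_compl, apply_mem_oddSet_twist]
    · rw [Finset.mem_inter] at hy ⊢
      rw [Finset.mem_compl, ← hQA τ hτQ hτK, ← apply_mem_oddSet_twist (1 : L ≃ₐ[k] L) τ]
      simpa using hy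
  have hdisj : Disjoint (S w) (S w₂) := by
    rw [Finset.disjoint_left]
    intro u hu hu'
    obtain ⟨⟨γ, g⟩, -, rfl⟩ := Finset.mem_image.1 hu
    obtain ⟨⟨γ', g'⟩, -, h⟩ := Finset.mem_image.1 hu'
    have h' : twist γ g w = twist γ' ((g' : Equiv.Perm α) * τ) w := by
      rw [← h, hw₂]
      funext x
      simp [twist]
    have hfix := twist_eq_twist h'
    set h₀ := ((g' : Equiv.Perm α) * τ)⁻¹ * (g : Equiv.Perm α) with hh₀
    set δ := γ'⁻¹ * γ
    have hgτ : (g' : Equiv.Perm α) * τ ∉ K := fun hmem => hτK (by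
      simpa using K.mul_mem (K.inv_mem g'.2) hmem)
    have hh₀Q : h₀ ∈ Q := mul_mem (inv_mem (mul_mem (hKQ _ g'.2) hτQ)) (hKQ _ g.2)
    have hh₀K : h₀ ∉ K := fun hmem => hgτ (by
      have := K.mul_mem g.2 (K.inv_mem hmem)
      simpa [hh₀] using this)
    refine hinv (∏ x ∈ A, w x) (by rw [← Finset.prod_pow, hwp]) δ ?_
    refine eq_inv_of_mul_eq_one_right ?_
    rw [map_prod, ← hΛ.prod_eq_one w hw,
      ← Finset.prod_mul_prod_compl A w]
    congr 1
    refine Finset.prod_bij (fun x _ => h₀ x) (fun x hx => ?_)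
      (fun x _ y _ h => h₀.injective h) (fun y hy => ⟨h₀⁻¹ y, ?_, by simp⟩) (fun x _ => ?_)
    · rw [Finset.mem_compl, hQA h₀ hh₀Q hh₀K]
      simpa using hx
    · rw [Finset.mem_compl] at hy
      by_contra hcon
      exact hy (by simpa using (hQA h₀ hh₀Q hh₀K _).2 hcon)
    · have := congrFun hfix (h₀ x)
      rwa [twist, perm_inv_apply_self] at this
  calc Nat.card (L ≃ₐ[k] L) * 2 ^ (2 * t + 1)
      = Nat.card (L ≃ₐ[k] L) * 2 ^ (2 * t) + Nat.card (L ≃ₐ[k] L) * 2 ^ (2 * t) := by ring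
    _ ≤ (S w).card + (S w₂).card :=
        Nat.add_le_add (hbound w hw hwodd _ (hS w)) (hbound w₂ hw₂Λ hw₂odd _ (hS w₂))
    _ = (S w ∪ S w₂).card := (Finset.card_union_of_disjoint hdisj).symm
    _ ≤ Λ.card := Finset.card_le_card (Finset.union_subset (hSΛ w hw) (hSΛ w₂ hw₂Λ))

theorem padicValNat_pow_sub_one_of_mod_four {q m : ℕ} (hq : q % 4 = 1) (hq1 : 1 < q)
    (hm : m ≠ 0) : padicValNat 2 (q ^ m - 1) = padicValNat 2 (q - 1) + padicValNat 2 m := by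
  have h1 : 1 < q ^ m := Nat.one_lt_pow hm hq1
  rw [← Nat.cast_inj (R := ℕ∞), Nat.cast_add, padicValNat_eq_emultiplicity (by omega),
    padicValNat_eq_emultiplicity (by omega), padicValNat_eq_emultiplicity hm]
  have := Int.two_pow_sub_pow' (x := q) (y := 1) m (by omega) (by omega)
  rw [one_pow] at this
  rw [← Int.natCast_emultiplicity, ← Int.natCast_emultiplicity, ← Int.natCast_emultiplicity,
    Nat.cast_sub h1.le, Nat.cast_sub hq1.le]
  exact_mod_cast this

theorem padicValNat_card_GL {q n : ℕ} (hq4 : q % 4 = 1) (hq1 : 1 < q) (F : Type*) [Field F]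
    [Fintype F] (hF : Fintype.card F = q) :
    padicValNat 2 (Nat.card (Matrix.GeneralLinearGroup (Fin n) F)) =
      padicValNat 2 (q - 1) * n + padicValNat 2 n.factorial := by
  have hodd : ¬ 2 ∣ q := by omega
  have key : ∀ l, padicValNat 2 (∏ i ∈ Finset.range l, (q ^ (i + 1) - 1)) =
      padicValNat 2 (q - 1) * l + padicValNat 2 l.factorial := by
    intro l
    have hne : ∀ i, q ^ (i + 1) - 1 ≠ 0 := fun i =>
      Nat.sub_ne_zero_of_lt (Nat.one_lt_pow (by omega) hq1)
    induction l with
    | zero => simp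
    | succ l ih =>
      rw [Finset.prod_range_succ, padicValNat.mul (Finset.prod_ne_zero_iff.2 fun i _ => hne i)
        (hne l), ih, padicValNat_pow_sub_one_of_mod_four hq4 hq1 (by omega), Nat.factorial_succ,
        padicValNat.mul (by omega) (Nat.factorial_ne_zero l)]
      ring
  rw [Matrix.card_GL_field, hF, ← key n,
    Finset.prod_range (fun i : ℕ => q ^ (i + 1) - 1)]
  rw [← Equiv.prod_comp Fin.revPerm (fun i : Fin n => q ^ ((i : ℕ) + 1) - 1)]
  have hfac : ∀ i : Fin n, q ^ n - q ^ (i : ℕ) =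
      q ^ (i : ℕ) * (q ^ ((Fin.revPerm i : Fin n) + 1 : ℕ) - 1) := by
    intro i
    rw [Fin.revPerm_apply, Fin.val_rev, Nat.mul_sub, mul_one, ← pow_add]
    congr 2
    omega
  rw [Finset.prod_congr rfl fun i _ => hfac i, Finset.prod_mul_distrib, padicValNat.mul]
  · rw [padicValNat.eq_zero_of_not_dvd, zero_add]
    rw [Nat.prime_two.prime.dvd_finsetProd_iff]
    rintro ⟨i, -, hi⟩
    exact hodd (Nat.prime_two.dvd_of_dvd_pow hi)
  · exact Finset.prod_ne_zero_iff.2 fun i _ => by positivity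
  · exact Finset.prod_ne_zero_iff.2 fun i _ =>
      Nat.sub_ne_zero_of_lt (Nat.one_lt_pow (by omega) hq1)

theorem padicValNat_card_PGL {q n : ℕ} (hn : n ≠ 0) (hq4 : q % 4 = 1) (hq1 : 1 < q) (F : Type*)
    [Field F] [Fintype F] (hF : Fintype.card F = q) :
    padicValNat 2 (Nat.card (Matrix.GeneralLinearGroup (Fin n) F ⧸
        Subgroup.center (Matrix.GeneralLinearGroup (Fin n) F))) + padicValNat 2 (q - 1) =
      padicValNat 2 (q - 1) * n + padicValNat 2 n.factorial := by
  have hc : Nat.card (Subgroup.center (Matrix.GeneralLinearGroup (Fin n) F)) = q - 1 := by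
    have : Nonempty (Fin n) := ⟨⟨0, by omega⟩⟩
    have hinj : Function.Injective (Matrix.GeneralLinearGroup.scalar (Fin n) (R := F)) := by
      intro a b hab
      have := congrArg (fun M : Matrix.GeneralLinearGroup (Fin n) F => M.1) hab
      exact Units.ext (Matrix.scalar_inj.1 this)
    rw [Matrix.GeneralLinearGroup.center_eq_range_scalar, ← hF, ← Nat.card_eq_fintype_card,
      ← Nat.card_units]
    exact (Nat.card_congr (MonoidHom.ofInjective hinj).toEquiv).symm
  rw [← padicValNat_card_GL hq4 hq1 F hF, Subgroup.card_eq_card_quotient_mul_card_subgroup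
    (Subgroup.center (Matrix.GeneralLinearGroup (Fin n) F)), padicValNat.mul, hc]
  · exact Nat.card_pos.ne'
  · exact Nat.card_pos.ne'

/-- The group of monomial matrices with entries in `C` and permutation part in `Q`. -/
abbrev Monomial (C : Type*) [CommGroup C] {α : Type*} (Q : Subgroup (Equiv.Perm α)) : Type _ :=
  (α → C) ⋊[(mulAutArrow : Q →* MulAut (α → C))] Q

theorem Monomial.mul_left_apply {C : Type*} [CommGroup C] {α : Type*} {Q : Subgroup (Equiv.Perm α)}
    (a b : Monomial C Q) (x : α) :
    (a * b).left x = a.left x * b.left ((a.right : Equiv.Perm α)⁻¹ x) := rfl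

theorem Monomial.mul_right_apply {C : Type*} [CommGroup C] {α : Type*}
    {Q : Subgroup (Equiv.Perm α)} (a b : Monomial C Q) (x : α) :
    ((a * b).right : Equiv.Perm α) x = (a.right : Equiv.Perm α) ((b.right : Equiv.Perm α) x) := rfl

/-- The realization of the monomial group by matrices. -/
def monomialMatrix {C F α : Type*} [CommGroup C] [Field F] [Fintype α] [DecidableEq α]
    (j : C →* Fˣ) (Q : Subgroup (Equiv.Perm α)) : Monomial C Q →* Matrix α α F where
  toFun h := Matrix.of fun x y => if x = (h.right : Equiv.Perm α) y then (j (h.left x) : F) else 0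
  map_one' := by
    ext x y
    simp [Matrix.one_apply]
  map_mul' a b := by
    ext x y
    rw [Matrix.mul_apply]
    simp only [Matrix.of_apply, Monomial.mul_left_apply]
    rw [Finset.sum_eq_single ((b.right : Equiv.Perm α) y)]
    · by_cases h : x = ((a * b).right : Equiv.Perm α) y
      · have h' := h.trans (Monomial.mul_right_apply a b y)
        rw [if_pos h, if_pos h', if_pos rfl, map_mul, Units.val_mul, h', perm_inv_apply_self]
      · rw [if_neg h, if_neg fun h' => h (h'.trans (Monomial.mul_right_apply a b y).symm), zero_mul]
    · intro z _ hz
      rw [if_neg hz, mul_zero]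
    · simp

theorem monomialMatrix_mem_center {C F α : Type*} [CommGroup C] [Field F] [Fintype α]
    [DecidableEq α] [Nonempty α] {j : C →* Fˣ} (hj : Function.Injective j)
    (Q : Subgroup (Equiv.Perm α)) (h : Monomial C Q) :
    (monomialMatrix j Q).toHomUnits h ∈ Subgroup.center (Matrix.GeneralLinearGroup α F) ↔
      h.right = 1 ∧ ∀ x y, h.left x = h.left y := by
  rw [Matrix.GeneralLinearGroup.mem_center_iff_val_mem_range_scalar, MonoidHom.coe_toHomUnits]
  constructor
  · rintro ⟨c, hc⟩
    have hent : ∀ x y, (if x = y then c else 0) =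
        if x = (h.right : Equiv.Perm α) y then (j (h.left x) : F) else 0 := by
      intro x y
      have := congrFun (congrFun hc x) y
      rwa [Matrix.scalar_apply, Matrix.diagonal_apply] at this
    have hr : ∀ y, (h.right : Equiv.Perm α) y = y := by
      intro y
      by_contra hne
      have := hent ((h.right : Equiv.Perm α) y) y
      rw [if_neg hne, if_pos rfl] at this
      exact (Units.ne_zero _) this.symm
    refine ⟨Subtype.ext (Equiv.ext hr), fun x y => hj (Units.ext ?_)⟩
    have hx := hent x x
    have hy := hent y y
    rw [hr, if_pos rfl, if_pos rfl] at hx hy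
    rw [← hx, ← hy]
  · rintro ⟨h1, h2⟩
    obtain ⟨x₀⟩ := ‹Nonempty α›
    refine ⟨j (h.left x₀), ?_⟩
    ext x y
    rw [Matrix.scalar_apply, Matrix.diagonal_apply, h2 x₀ x]
    simp [monomialMatrix, h1]

/-- A Sylow `2`-subgroup of `PGL_n(F)` is the quotient of a monomial group by the scalars. -/
theorem exists_surjective_monomial {q s n : ℕ} (hn : n ≠ 0) (hq4 : q % 4 = 1) (hq1 : 1 < q)
    (hs : s = padicValNat 2 (q - 1)) {F : Type*} [Field F] [Fintype F] (hF : Fintype.card F = q)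
    (P : Sylow 2 (Matrix.GeneralLinearGroup (Fin n) F ⧸
      Subgroup.center (Matrix.GeneralLinearGroup (Fin n) F)))
    {C : Type*} [CommGroup C] [Finite C] (hC : Nat.card C = 2 ^ s) {j : C →* Fˣ}
    (hj : Function.Injective j) (Q : Sylow 2 (Equiv.Perm (Fin n))) :
    ∃ π : Monomial C (Q : Subgroup (Equiv.Perm (Fin n))) →* P, Function.Surjective π ∧
      ∀ h, π h = 1 ↔ h.right = 1 ∧ ∀ x y, h.left x = h.left y := by
  have : Nonempty (Fin n) := ⟨⟨0, by omega⟩⟩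
  let H := Monomial C (Q : Subgroup (Equiv.Perm (Fin n)))
  let f : H →* _ := (QuotientGroup.mk' (Subgroup.center (Matrix.GeneralLinearGroup (Fin n) F))).comp
    (monomialMatrix j (Q : Subgroup (Equiv.Perm (Fin n)))).toHomUnits
  have hf : ∀ h, f h = 1 ↔ h.right = 1 ∧ ∀ x y, h.left x = h.left y := fun h =>
    (QuotientGroup.eq_one_iff _).trans (monomialMatrix_mem_center hj _ h)
  have hker : Nat.card f.ker = 2 ^ s := by
    rw [← hC]
    refine (Nat.card_congr (Equiv.ofBijective
      (fun c => (⟨⟨fun _ => c, 1⟩, (hf _).2 ⟨rfl, fun _ _ => rfl⟩⟩ : f.ker)) ⟨?_, ?_⟩)).symm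
    · intro a b hab
      exact congrFun (congrArg (fun h : f.ker => h.1.left) hab) ⟨0, by omega⟩
    · rintro ⟨h, hh⟩
      obtain ⟨h1, h2⟩ := (hf h).1 hh
      exact ⟨h.left ⟨0, by omega⟩, Subtype.ext (SemidirectProduct.ext (funext fun x => h2 _ _)
        h1.symm)⟩
  have hQ : Nat.card Q = 2 ^ padicValNat 2 n.factorial := by
    rw [Q.card_eq_multiplicity, Nat.card_eq_fintype_card, Fintype.card_perm, Fintype.card_fin,
      Nat.factorization_def _ Nat.prime_two]
  have hH : Nat.card H = 2 ^ (s * n + padicValNat 2 n.factorial) := by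
    rw [SemidirectProduct.card, Nat.card_fun, hC, Nat.card_fin, pow_add, ← pow_mul]
    exact congrArg _ hQ
  have hrange : Nat.card f.range = 2 ^ (Nat.card (Matrix.GeneralLinearGroup (Fin n) F ⧸
      Subgroup.center (Matrix.GeneralLinearGroup (Fin n) F))).factorization 2 := by
    rw [Nat.factorization_def _ Nat.prime_two]
    have h1 := f.ker.card_mul_index
    rw [Subgroup.index_ker, hker, hH, hs, ← padicValNat_card_PGL hn hq4 hq1 F hF, pow_add,
      mul_comm] at h1
    exact Nat.eq_of_mul_eq_mul_right (by positivity) h1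
  let e : f.range ≃* P := Sylow.equiv (Sylow.ofCard f.range hrange) P
  refine ⟨e.toMonoidHom.comp f.rangeRestrict, e.surjective.comp f.rangeRestrict_surjective,
    fun h => ?_⟩
  rw [← hf, MonoidHom.comp_apply]
  refine (e.map_eq_one_iff (x := f.rangeRestrict h)).trans ?_
  rw [Subtype.ext_iff]
  rfl

theorem iSup_eigenspace_eq_top_of_pow_eq_one {L V : Type*} [Field L] [AddCommGroup V] [Module L V]
    {f : Module.End L V} {N : ℕ} {ζ : L} (hζ : IsPrimitiveRoot ζ N) (hN : N ≠ 0)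
    (hf : f ^ N = 1) : ⨆ μ, f.eigenspace μ = ⊤ := by
  classical
  have key : ∀ S : Finset L, LinearMap.ker (Polynomial.aeval f
      (∏ μ ∈ S, (Polynomial.X - Polynomial.C μ))) ≤ ⨆ μ, f.eigenspace μ := by
    intro S
    induction S using Finset.induction_on with
    | empty => simp [Module.End.one_eq_id]
    | insert μ S hμ ih =>
      rw [Finset.prod_insert hμ, ← Polynomial.sup_ker_aeval_eq_ker_aeval_mul_of_coprime]
      · refine sup_le (le_trans ?_ (le_iSup _ μ)) ih
        intro v hv
        rw [LinearMap.mem_ker] at hv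
        rw [Module.End.mem_eigenspace_iff, ← sub_eq_zero]
        simpa using hv
      · refine IsCoprime.prod_right fun ν hν => ?_
        exact Polynomial.isCoprime_X_sub_C_of_isUnit_sub
          (sub_ne_zero.2 (ne_of_mem_of_not_mem hν hμ).symm).isUnit
  rw [eq_top_iff]
  refine le_trans ?_ (key (Polynomial.nthRootsFinset N (1 : L)))
  rw [← Polynomial.X_pow_sub_one_eq_prod (Nat.pos_of_ne_zero hN) hζ]
  simp [hf]

/-- The joint eigenvalues of a commuting family of endomorphisms of finite order. -/
theorem exists_joint_eigenvalues {ι L V : Type*} [Field L] [AddCommGroup V] [Module L V]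
    [FiniteDimensional L V] (f : ι → Module.End L V) (hcomm : ∀ i j, Commute (f i) (f j)) {N : ℕ}
    (hN : (N : L) ≠ 0) {ζ : L} (hζ : IsPrimitiveRoot ζ N) (hf : ∀ i, f i ^ N = 1) :
    ∃ Λ : Finset (ι → L), Λ.card ≤ Module.finrank L V ∧
      (∀ w, w ∈ Λ ↔ ∃ v ≠ 0, ∀ i, f i v = w i • v) ∧
      ∀ T : Module.End L V,
        (∀ w ∈ Λ, ∀ v, (∀ i, f i v = w i • v) → T v = v) → T = 1 := by
  classical
  have hN0 : N ≠ 0 := fun h => hN (by rw [h, Nat.cast_zero])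
  have hsq : Squarefree (Polynomial.X ^ N - 1 : Polynomial L) :=
    (Polynomial.X_pow_sub_one_separable_iff.2 hN).squarefree
  have hmax : ∀ i μ, (f i).maxGenEigenspace μ = (f i).eigenspace μ := fun i μ =>
    (Module.End.isSemisimple_of_squarefree_aeval_eq_zero hsq
      (by simp [hf i])).isFinitelySemisimple.maxGenEigenspace_eq_eigenspace μ
  have hmem : ∀ (w : ι → L) v, v ∈ ⨅ i, (f i).maxGenEigenspace (w i) ↔
      ∀ i, f i v = w i • v := by
    intro w v
    simp_rw [Submodule.mem_iInf, hmax, Module.End.mem_eigenspace_iff]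
  have hmaps : ∀ (i j : ι) (μ : L), Set.MapsTo (f i) ((f j).maxGenEigenspace μ)
      ((f j).maxGenEigenspace μ) := fun i j μ =>
    Module.End.mapsTo_maxGenEigenspace_of_comm (hcomm j i) μ
  have hind := Module.End.independent_iInf_maxGenEigenspace_of_forall_mapsTo f hmaps
  have htop := Module.End.iSup_iInf_maxGenEigenspace_eq_top_of_forall_mapsTo f hmaps fun i => by
    simp_rw [hmax]
    exact iSup_eigenspace_eq_top_of_pow_eq_one hζ hN0 (hf i)
  let W := {w : ι → L // ⨅ i, (f i).maxGenEigenspace (w i) ≠ ⊥}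
  have hfin : Finite W := by
    rw [← Cardinal.lt_aleph0_iff_finite]
    exact hind.subtype_ne_bot_le_finrank_aux.trans_lt ((Cardinal.natCast_lt_aleph0))
  have : Fintype W := Fintype.ofFinite W
  refine ⟨Finset.univ.map (Function.Embedding.subtype _ : W ↪ (ι → L)), ?_, ?_, ?_⟩
  · rw [Finset.card_map]
    exact hind.subtype_ne_bot_le_finrank
  · intro w
    have hw : w ∈ Finset.univ.map (Function.Embedding.subtype _ : W ↪ (ι → L)) ↔
        ⨅ i, (f i).maxGenEigenspace (w i) ≠ ⊥ := by simp [W]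
    rw [hw, Submodule.ne_bot_iff]
    simp_rw [hmem]
    exact ⟨fun ⟨v, h, h'⟩ => ⟨v, h', h⟩, fun ⟨v, h, h'⟩ => ⟨v, h', h⟩⟩
  · intro T hT
    have hle : ⨆ χ : ι → L, ⨅ i, (f i).maxGenEigenspace (χ i) ≤ LinearMap.eqLocus T 1 := by
      refine iSup_le fun w v hv => ?_
      rw [LinearMap.mem_eqLocus]
      by_cases hw : ⨅ i, (f i).maxGenEigenspace (w i) = ⊥
      · rw [hw, Submodule.mem_bot] at hv
        rw [hv, map_zero, map_zero]
      · exact hT w (Finset.mem_map.2 ⟨⟨w, hw⟩, Finset.mem_univ _, rfl⟩) v ((hmem w v).1 hv)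
    rw [htop] at hle
    exact LinearMap.ext fun v => hle (Submodule.mem_top (x := v))

/-- The weights of a faithful representation of a monomial group modulo scalars. -/
theorem exists_isWeightSet {k L α C G : Type*} [Field k] [Field L] [Algebra k L] [Fintype α]
    [DecidableEq α] [CommGroup C] [Group G] {Q : Subgroup (Equiv.Perm α)} {π : Monomial C Q →* G}
    (hπ : ∀ h, π h = 1 ↔ h.right = 1 ∧ ∀ x y, h.left x = h.left y) {c : C} {m : ℕ}
    (hc : c ^ 2 ^ (m + 1) = 1) (hc' : c ^ 2 ^ m ≠ 1) (h2 : (2 : L) ≠ 0) {ζ : L}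
    (hζ : IsPrimitiveRoot ζ (2 ^ (m + 1))) {d : ℕ} {φ : G →* Matrix.GeneralLinearGroup (Fin d) k}
    (hφ : Function.Injective φ) :
    ∃ Λ : Finset (α → L), IsWeightSet k m Q Λ ∧ Λ.card ≤ d := by
  let R : Monomial C Q →* Module.End L (Fin d → L) :=
    ((Matrix.toLinAlgEquiv' : Matrix (Fin d) (Fin d) L ≃ₐ[L] _) :
      Matrix (Fin d) (Fin d) L →* Module.End L (Fin d → L)).comp
      (((algebraMap k L).mapMatrix : Matrix (Fin d) (Fin d) k →+* Matrix (Fin d) (Fin d) L).toMonoidHom.comp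
        ((Units.coeHom (Matrix (Fin d) (Fin d) k)).comp (φ.comp π)))
  have hR : ∀ h v, R h v = ((φ (π h)).1.map (algebraMap k L)).mulVec v := fun _ _ => rfl
  have hR1 : ∀ h, R h = 1 → π h = 1 := by
    intro h hh
    refine (injective_iff_map_eq_one φ).1 hφ _ (Units.ext ?_)
    have h1 : (φ (π h)).1.map (algebraMap k L) = (1 : Matrix (Fin d) (Fin d) k).map
        (algebraMap k L) := by
      rw [Matrix.map_one _ (map_zero _) (map_one _)]
      exact Matrix.toLinAlgEquiv'.injective (hh.trans (map_one _).symm)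
    exact Matrix.map_injective (algebraMap k L).injective h1
  have hRγ : ∀ (γ : L ≃ₐ[k] L) h (v : Fin d → L), R h (γ ∘ v) = γ ∘ R h v := by
    intro γ h v
    funext i
    simp [hR, Matrix.mulVec, dotProduct]
  let ι : (α → C) →* Monomial C Q := SemidirectProduct.inl
  have hιpow : ∀ x e, ι (Pi.mulSingle x (c ^ e)) = ι (Pi.mulSingle x c) ^ e := by
    intro x e
    rw [← map_pow, Pi.mulSingle_pow]
  obtain ⟨Λ, hcard, hΛ, hT⟩ := exists_joint_eigenvalues (fun x => R (ι (Pi.mulSingle x c)))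
    (fun x y => ((Commute.all _ _).map ι).map R) (N := 2 ^ (m + 1))
    (by push_cast; exact pow_ne_zero _ h2) hζ
    (fun x => by rw [← map_pow, ← hιpow, hc, Pi.mulSingle_one, map_one, map_one])
  have hprod : ∀ (w : α → L) v, (∀ x, R (ι (Pi.mulSingle x c)) v = w x • v) →
      ∀ (e : ℕ) (A : Finset α), R (ι (∏ x ∈ A, Pi.mulSingle x (c ^ e))) v =
        (∏ x ∈ A, w x ^ e) • v := by
    intro w v hv e A
    have hpow : ∀ x (e : ℕ), (R (ι (Pi.mulSingle x c)) ^ e) v = w x ^ e • v := by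
      intro x e
      induction e with
      | zero => simp
      | succ e ih => rw [pow_succ, Module.End.mul_apply, hv, map_smul, ih, smul_smul, pow_succ']
    induction A using Finset.induction_on with
    | empty => simp
    | insert x A hx ih =>
      rw [Finset.prod_insert hx, Finset.prod_insert hx, map_mul, map_mul, Module.End.mul_apply, ih,
        map_smul, hιpow, map_pow, hpow, smul_smul, mul_comm]
  have hone : ∀ w ∈ Λ, ∀ x, w x ^ 2 ^ (m + 1) = 1 := by
    intro w hw x
    obtain ⟨v, hv0, hv⟩ := (hΛ w).1 hw
    have := hprod w v hv (2 ^ (m + 1)) {x}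
    rw [Finset.prod_singleton, Finset.prod_singleton, hc, Pi.mulSingle_one, map_one, map_one] at this
    exact (smul_left_injective L hv0 (by simpa using this)).symm
  refine ⟨Λ, ⟨hone, ?_, ?_, ?_⟩, by simpa using hcard⟩
  · intro w hw
    obtain ⟨v, hv0, hv⟩ := (hΛ w).1 hw
    have := hprod w v hv 1 Finset.univ
    rw [Finset.univ_prod_mulSingle (fun _ => c ^ 1)] at this
    have h1 : R (ι fun _ => c ^ 1) = 1 := by
      have : π (ι fun _ => c ^ 1) = 1 := (hπ _).2 ⟨rfl, fun _ _ => rfl⟩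
      simp only [R, MonoidHom.comp_apply, this, map_one]
    rw [h1] at this
    simp only [pow_one] at this
    exact (smul_left_injective L hv0 (by simpa using this)).symm
  · intro w hw γ g hg
    obtain ⟨v, hv0, hv⟩ := (hΛ w).1 hw
    let g' : Monomial C Q := SemidirectProduct.inr ⟨g, hg⟩
    have hconj : ∀ x, ι (Pi.mulSingle x c) * g' = g' * ι (Pi.mulSingle (g⁻¹ x) c) := by
      intro x
      refine SemidirectProduct.ext (funext fun y => ?_) ?_
      · rw [Monomial.mul_left_apply, Monomial.mul_left_apply]
        change (Pi.mulSingle x c : α → C) y * 1 = 1 * (Pi.mulSingle (g⁻¹ x) c : α → C) (g⁻¹ y)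
        simp only [mul_one, one_mul, Pi.mulSingle_apply, EmbeddingLike.apply_eq_iff_eq]
      · change 1 * (⟨g, hg⟩ : Q) = ⟨g, hg⟩ * 1
        rw [one_mul, mul_one]
    refine (hΛ _).2 ⟨R g' (γ ∘ v), ?_, fun x => ?_⟩
    · intro h0
      have h1 : R g'⁻¹ (R g' (γ ∘ v)) = γ ∘ v := by
        rw [← Module.End.mul_apply, ← map_mul, inv_mul_cancel, map_one, Module.End.one_apply]
      rw [h0, map_zero] at h1
      refine hv0 (funext fun i => γ.injective ?_)
      rw [Pi.zero_apply, map_zero]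
      exact (congrFun h1 i).symm
    · rw [← Module.End.mul_apply, ← map_mul, hconj, map_mul, Module.End.mul_apply, hRγ, hv]
      have : γ ∘ (w (g⁻¹ x) • v) = twist γ g w x • (γ ∘ v) := by
        funext i
        simp [twist]
      rw [this, map_smul]
  · intro A hA hA'
    by_contra! hcon
    have hz := hR1 (ι (∏ x ∈ A, Pi.mulSingle x (c ^ 2 ^ m))) (hT _ fun w hw v hv => by
      have h1 : (∏ x ∈ A, w x ^ 2 ^ m) ^ 2 = 1 := by
        rw [← Finset.prod_pow]
        exact Finset.prod_eq_one fun x _ => by rw [← pow_mul, ← pow_succ, hone w hw]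
      rw [hprod w v hv, (sq_eq_one_iff.1 h1).resolve_right (hcon w hw), one_smul])
    have h3 := ((hπ _).1 hz).2
    obtain ⟨x, hx⟩ := hA
    obtain ⟨y, hy⟩ : ∃ y, y ∉ A := by
      by_contra! h
      exact hA' (Finset.eq_univ_iff_forall.2 h)
    have hval : ∀ z, (ι (∏ x ∈ A, Pi.mulSingle x (c ^ 2 ^ m))).left z =
        if z ∈ A then c ^ 2 ^ m else 1 := by
      intro z
      change (∏ x ∈ A, (Pi.mulSingle x (c ^ 2 ^ m) : α → C)) z = _
      rw [Finset.prod_apply]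
      simp [Pi.mulSingle_apply]
    have := h3 x y
    rw [hval, hval, if_pos hx, if_neg hy] at this
    exact hc' this

/-- The action of the monomial group on functions of pairs of indices, on which scalars act
trivially. -/
def pairAction (k : Type*) {L α C : Type*} [Field k] [Field L] [Algebra k L] [CommGroup C]
    (j : C →* Lˣ) (Q : Subgroup (Equiv.Perm α)) : Monomial C Q →* Module.End k (α × α → L) where
  toFun h :=
    { toFun f p := (j (h.left p.1 / h.left p.2) : L) *
        f ((h.right : Equiv.Perm α)⁻¹ p.1, (h.right : Equiv.Perm α)⁻¹ p.2)
      map_add' f₁ f₂ := by funext p; simp [mul_add]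
      map_smul' a f := by funext p; simp }
  map_one' := by
    ext f p
    simp
  map_mul' a b := by
    ext f p
    have h : (((a * b).right : Q) : Equiv.Perm α)⁻¹ =
        (b.right : Equiv.Perm α)⁻¹ * (a.right : Equiv.Perm α)⁻¹ := mul_inv_rev _ _
    simp only [LinearMap.coe_mk, AddHom.coe_mk, Module.End.mul_apply, Monomial.mul_left_apply, h,
      Equiv.Perm.mul_apply, mul_div_mul_comm, map_mul, Units.val_mul, mul_assoc]

theorem pairAction_apply {k L α C : Type*} [Field k] [Field L] [Algebra k L] [CommGroup C]
    (j : C →* Lˣ) (Q : Subgroup (Equiv.Perm α)) (h : Monomial C Q) (f : α × α → L) (x y : α) :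
    pairAction k j Q h f (x, y) = (j (h.left x / h.left y) : L) *
      f ((h.right : Equiv.Perm α)⁻¹ x, (h.right : Equiv.Perm α)⁻¹ y) := rfl

/-- An invariant subspace on which only scalars act trivially gives a faithful representation. -/
theorem exists_injective_of_pairAction {k L α C G : Type*} [Field k] [Field L] [Algebra k L]
    [FiniteDimensional k L] [Fintype α] [CommGroup C] [Group G] {Q : Subgroup (Equiv.Perm α)}
    {π : Monomial C Q →* G} (hsurj : Function.Surjective π)
    (hπ : ∀ h, π h = 1 ↔ h.right = 1 ∧ ∀ x y, h.left x = h.left y) (j : C →* Lˣ)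
    (V : Submodule k (α × α → L)) (hV : ∀ h, ∀ f ∈ V, pairAction k j Q h f ∈ V)
    (hfaith : ∀ h, (∀ f ∈ V, pairAction k j Q h f = f) →
      h.right = 1 ∧ ∀ x y, h.left x = h.left y)
    (S : Finset (α × α)) (hS : ∀ f ∈ V, (∀ p ∈ S, f p = 0) → f = 0) :
    ∃ d ≤ S.card * Module.finrank k L, ∃ φ : G →* Matrix.GeneralLinearGroup (Fin d) k,
      Function.Injective φ := by
  let ρ : Monomial C Q →* Module.End k V :=
    { toFun h := (pairAction k j Q h).restrict (hV h)
      map_one' := by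
        ext f : 2
        simp
      map_mul' a b := by
        ext f : 2
        simp }
  have hρ : ∀ h (f : V), (ρ h f : α × α → L) = pairAction k j Q h f := fun _ _ => rfl
  let b := Module.finBasis k V
  let ψ : Monomial C Q →* Matrix.GeneralLinearGroup (Fin (Module.finrank k V)) k :=
    (((LinearMap.toMatrixAlgEquiv b : _ ≃ₐ[k] _) : Module.End k V →* _).comp ρ).toHomUnits
  have hψ : ∀ h, ψ h = 1 ↔ π h = 1 := by
    intro h
    have h1 : ψ h = 1 ↔ ρ h = 1 := by
      rw [Units.ext_iff]
      exact map_eq_one_iff (LinearMap.toMatrixAlgEquiv b) (LinearMap.toMatrixAlgEquiv b).injective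
    rw [h1, hπ]
    constructor
    · intro h2
      refine hfaith h fun f hf => ?_
      rw [← hρ h ⟨f, hf⟩, h2, Module.End.one_apply]
    · rintro ⟨h2, h3⟩
      ext f x : 3
      rw [hρ, ← Prod.mk.eta (p := x), pairAction_apply, h2, h3 x.1 x.2]
      simp
  let φ := MonoidHom.liftOfSurjective π hsurj ⟨ψ, fun h hh => (hψ h).2 hh⟩
  have hφ : ∀ h, φ (π h) = ψ h := fun h =>
    MonoidHom.liftOfRightInverse_comp_apply _ _ _ _ h
  refine ⟨Module.finrank k V, ?_, φ, ?_⟩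
  · let r : V →ₗ[k] (S → L) := (LinearMap.funLeft k L Subtype.val).comp V.subtype
    have hr : Function.Injective r := by
      rw [← LinearMap.ker_eq_bot, LinearMap.ker_eq_bot']
      intro f hf
      exact Subtype.ext (hS f.1 f.2 fun p hp => congrFun hf ⟨p, hp⟩)
    have := LinearMap.finrank_le_finrank_of_injective hr
    rwa [Module.finrank_pi_fintype, Finset.sum_const, Finset.card_univ, Fintype.card_coe,
      smul_eq_mul] at this
  · rw [injective_iff_map_eq_one]
    intro g hg
    obtain ⟨h, rfl⟩ := hsurj g
    rw [hφ] at hg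
    exact (hψ h).1 hg

theorem Monomial.eq_const_of_forall {C : Type*} [CommGroup C] {α : Type*}
    {Q : Subgroup (Equiv.Perm α)} (h : Monomial C Q) (A : Finset α) (hA : A.Nonempty)
    (hA' : ∃ y, y ∉ A) (H : ∀ x ∈ A, ∀ y ∉ A, (h.right : Equiv.Perm α)⁻¹ x = x ∧
      (h.right : Equiv.Perm α)⁻¹ y = y ∧ h.left x = h.left y) :
    h.right = 1 ∧ ∀ x y, h.left x = h.left y := by
  obtain ⟨x₀, hx₀⟩ := hA
  obtain ⟨y₀, hy₀⟩ := hA'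
  have hfix : ∀ z, (h.right : Equiv.Perm α)⁻¹ z = z := by
    intro z
    by_cases hz : z ∈ A
    · exact (H z hz y₀ hy₀).1
    · exact (H x₀ hx₀ z hz).2.1
  have hconst : ∀ z, h.left z = h.left x₀ := by
    intro z
    by_cases hz : z ∈ A
    · exact (H z hz y₀ hy₀).2.2.trans (H x₀ hx₀ y₀ hy₀).2.2.symm
    · exact (H x₀ hx₀ z hz).2.2.symm
  refine ⟨?_, fun x y => (hconst x).trans (hconst y).symm⟩
  rw [← inv_eq_one]
  exact Subtype.ext (Equiv.ext hfix)

/-- The functions supported on `E`, as a subspace. -/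
def supportedOn (k : Type*) {L β : Type*} [Field k] [Field L] [Algebra k L] (E : Finset β) :
    Submodule k (β → L) where
  carrier := {f | ∀ p ∉ E, f p = 0}
  add_mem' := by
    intro f g hf hg p hp
    rw [Pi.add_apply, hf p hp, hg p hp, add_zero]
  zero_mem' := fun _ _ => rfl
  smul_mem' := by
    intro a f hf p hp
    rw [Pi.smul_apply, hf p hp, smul_zero]

theorem perm_apply_inv_self {α : Type*} (g : Equiv.Perm α) (x : α) : g (g⁻¹ x) = x :=
  g.apply_symm_apply x

theorem pairAction_mem_supportedOn {k L α C : Type*} [Field k] [Field L] [Algebra k L]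
    [CommGroup C] {Q : Subgroup (Equiv.Perm α)} (j : C →* Lˣ) {E : Finset (α × α)}
    (hE : ∀ g ∈ Q, ∀ x y, (x, y) ∈ E → (g x, g y) ∈ E) (h : Monomial C Q) {f : α × α → L}
    (hf : f ∈ supportedOn k E) : pairAction k j Q h f ∈ supportedOn k E := by
  rintro ⟨x, y⟩ hp
  rw [pairAction_apply, hf, mul_zero]
  intro hmem
  have := hE _ h.right.2 _ _ hmem
  rw [perm_apply_inv_self, perm_apply_inv_self] at this
  exact hp this

/-- The faithful representation on the functions supported on an invariant set of pairs. -/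
theorem exists_injective_of_invariant (k : Type*) {L α C G : Type*} [Field k] [Field L]
    [Algebra k L]
    [FiniteDimensional k L] [Fintype α] [DecidableEq α] [CommGroup C] [Group G]
    {Q : Subgroup (Equiv.Perm α)} {π : Monomial C Q →* G} (hsurj : Function.Surjective π)
    (hπ : ∀ h, π h = 1 ↔ h.right = 1 ∧ ∀ x y, h.left x = h.left y) {j : C →* Lˣ}
    (hj : Function.Injective j) {E : Finset (α × α)}
    (hE : ∀ g ∈ Q, ∀ x y, (x, y) ∈ E → (g x, g y) ∈ E) (A : Finset α) (hA : A.Nonempty)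
    (hA' : ∃ y, y ∉ A) (hAE : ∀ x ∈ A, ∀ y ∉ A, (x, y) ∈ E) :
    ∃ d ≤ E.card * Module.finrank k L, ∃ φ : G →* Matrix.GeneralLinearGroup (Fin d) k,
      Function.Injective φ := by
  refine exists_injective_of_pairAction hsurj hπ j (supportedOn k E)
    (fun h f hf => pairAction_mem_supportedOn j hE h hf) (fun h hh => ?_) E
    (fun f hf hf' => funext fun p => ?_)
  · refine h.eq_const_of_forall A hA hA' fun x hx y hy => ?_
    have h1 := congrFun (hh (Pi.single (x, y) 1) fun p hp => Pi.single_eq_of_ne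
      (ne_of_mem_of_not_mem (hAE x hx y hy) hp).symm _) (x, y)
    rw [pairAction_apply, Pi.single_eq_same, Pi.single_apply] at h1
    split_ifs at h1 with h2
    · rw [Prod.mk.injEq] at h2
      refine ⟨h2.1, h2.2, ?_⟩
      rw [mul_one, Units.val_eq_one] at h1
      exact div_eq_one.1 ((injective_iff_map_eq_one j).1 hj _ h1)
    · rw [mul_zero] at h1
      exact absurd h1 zero_ne_one
  · by_cases hp : p ∈ E
    · exact hf' p hp
    · exact hf p hp

/-- The faithful representation on the functions supported on the pairs separated by `A`, and
compatible with an involution inverting the roots of unity. -/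
theorem exists_injective_of_involution {k L α C G : Type*} [Field k] [Field L] [Algebra k L]
    [FiniteDimensional k L] [Fintype α] [DecidableEq α] [CommGroup C] [Group G]
    {Q : Subgroup (Equiv.Perm α)} {π : Monomial C Q →* G} (hsurj : Function.Surjective π)
    (hπ : ∀ h, π h = 1 ↔ h.right = 1 ∧ ∀ x y, h.left x = h.left y) {j : C →* Lˣ}
    (hj : Function.Injective j) (A : Finset α) (hA : A.Nonempty) (hA' : ∃ y, y ∉ A)
    (hQ : ∀ g ∈ Q, (∀ x, g x ∈ A ↔ x ∈ A) ∨ ∀ x, g x ∈ A ↔ x ∉ A)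
    (σ : L ≃ₐ[k] L) (hσ : ∀ a, σ (σ a) = a) (hσ1 : σ ≠ 1) (hσj : ∀ c, σ (j c) = (j c⁻¹ : Lˣ)) :
    ∃ d ≤ A.card * Aᶜ.card * Module.finrank k L,
      ∃ φ : G →* Matrix.GeneralLinearGroup (Fin d) k, Function.Injective φ := by
  let E : Finset (α × α) := Finset.univ.filter fun p => (p.1 ∈ A ↔ p.2 ∉ A)
  have hE : ∀ x y, (x, y) ∈ E ↔ (x ∈ A ↔ y ∉ A) := by simp [E]
  let W : Submodule k (α × α → L) :=
    { carrier := {f | ∀ x y, f (y, x) = σ (f (x, y))}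
      add_mem' := by
        intro f g hf hg x y
        rw [Pi.add_apply, Pi.add_apply, hf, hg, map_add]
      zero_mem' := fun _ _ => (map_zero σ).symm
      smul_mem' := by
        intro a f hf x y
        rw [Pi.smul_apply, Pi.smul_apply, hf, map_smul] }
  rw [← Finset.card_product]
  refine exists_injective_of_pairAction hsurj hπ j (supportedOn k E ⊓ W)
    (fun h f hf => ⟨pairAction_mem_supportedOn j ?_ h hf.1, fun x y => ?_⟩) (fun h hh => ?_)
    (A ×ˢ Aᶜ) (fun f hf hf' => funext fun ⟨x, y⟩ => ?_)
  · intro g hg x y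
    rw [hE, hE]
    rcases hQ g hg with h | h
    · rw [h, h]; exact id
    · rw [h, h]; tauto
  · rw [pairAction_apply, pairAction_apply, hf.2, map_mul, hσj, inv_div]
  · refine h.eq_const_of_forall A hA hA' fun x hx y hy => ?_
    have hxy : x ≠ y := ne_of_mem_of_not_mem hx hy
    let F : L → α × α → L := fun c => Pi.single (x, y) c + Pi.single (y, x) (σ c)
    have hF : ∀ c, F c ∈ supportedOn k E ⊓ W := by
      intro c
      refine ⟨fun p hp => ?_, fun a b => ?_⟩
      · have h1 : p ≠ (x, y) := by
          rintro rfl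
          exact hp ((hE _ _).2 (by tauto))
        have h2 : p ≠ (y, x) := by
          rintro rfl
          exact hp ((hE _ _).2 (by tauto))
        simp [F, h1, h2]
      · simp only [F, Pi.add_apply, Pi.single_apply, Prod.mk.injEq, map_add, apply_ite σ, hσ,
          map_zero]
        rw [add_comm]
        simp only [and_comm]
    have h1 : ∀ c, (j (h.left x / h.left y) : L) *
        F c ((h.right : Equiv.Perm α)⁻¹ x, (h.right : Equiv.Perm α)⁻¹ y) = c := by
      intro c
      have := congrFun (hh (F c) (hF c)) (x, y)
      rw [pairAction_apply] at this
      rw [this]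
      simp [F, hxy]
    by_cases h2 : ((h.right : Equiv.Perm α)⁻¹ x, (h.right : Equiv.Perm α)⁻¹ y) = (x, y)
    · have h3 := h1 1
      rw [Prod.mk.injEq] at h2
      rw [h2.1, h2.2] at h3
      have h4 : F 1 (x, y) = 1 := by simp [F, hxy]
      rw [h4, mul_one, Units.val_eq_one] at h3
      exact ⟨h2.1, h2.2, div_eq_one.1 ((injective_iff_map_eq_one j).1 hj _ h3)⟩
    · exfalso
      have h3 : ∀ c, F c ((h.right : Equiv.Perm α)⁻¹ x, (h.right : Equiv.Perm α)⁻¹ y) =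
          if ((h.right : Equiv.Perm α)⁻¹ x, (h.right : Equiv.Perm α)⁻¹ y) = (y, x) then σ c
          else 0 := by
        intro c
        simp only [F, Pi.add_apply, Pi.single_apply, if_neg h2, zero_add]
      simp only [h3] at h1
      split_ifs at h1
      · have h4 := h1 1
        rw [map_one, mul_one] at h4
        refine hσ1 (AlgEquiv.ext fun c => ?_)
        have h5 := h1 c
        rwa [h4, one_mul] at h5
      · simpa using h1 1
  · by_cases hx : x ∈ A <;> by_cases hy : y ∈ A
    · exact hf.1 _ fun h => ((hE _ _).1 h).1 hx hy
    · exact hf' _ (Finset.mk_mem_product hx (Finset.mem_compl.2 hy))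
    · rw [hf.2 y x, hf' _ (Finset.mk_mem_product hy (Finset.mem_compl.2 hx)), map_zero]
      rfl
    · exact hf.1 _ fun h => hx (((hE _ _).1 h).2 hy)

theorem minFaithfulDim_eq {k G : Type*} [Field k] [Group G] {N : ℕ}
    (hle : ∃ d ≤ N, ∃ φ : G →* Matrix.GeneralLinearGroup (Fin d) k, Function.Injective φ)
    (hge : ∀ (d : ℕ) (φ : G →* Matrix.GeneralLinearGroup (Fin d) k), Function.Injective φ →
      N ≤ d) : minFaithfulDim k G = N := by
  obtain ⟨d, hd, hφ⟩ := hle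
  refine le_antisymm ((Nat.sInf_le hφ).trans hd) ?_
  obtain ⟨φ, hφ'⟩ := Nat.sInf_mem
    (s := {d : ℕ | ∃ φ : G →* Matrix.GeneralLinearGroup (Fin d) k, Function.Injective φ}) ⟨d, hφ⟩
  exact hge _ φ hφ'

/-- A Sylow `2`-subgroup of a symmetric group of degree `n` has an orbit of size the `2`-part
of `n`. -/
theorem exists_card_orbit_eq {α : Type*} [Fintype α] [DecidableEq α] [Nonempty α]
    (Q : Sylow 2 (Equiv.Perm α)) :
    ∃ x : α, Nat.card (MulAction.orbit Q x) = 2 ^ padicValNat 2 (Fintype.card α) := by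
  classical
  by_contra! hcon
  have hdvd (x : α) : 2 ^ (padicValNat 2 (Fintype.card α) + 1) ∣
      Nat.card (MulAction.orbit Q x) := by
    have h1 := hcon x
    have h2 := sylow_orbit_dvd Q x
    obtain ⟨a, ha⟩ := Q.isPGroup'.card_orbit x
    rw [ha] at h1 h2 ⊢
    rw [Nat.pow_dvd_pow_iff_le_right (by norm_num)] at h2
    exact pow_dvd_pow 2 (Nat.succ_le_of_lt (lt_of_le_of_ne h2 fun h => h1 (by rw [h])))
  have hsum : Fintype.card α = ∑ ω : MulAction.orbitRel.Quotient Q α,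
      Nat.card (MulAction.orbit Q ω.out) := by
    rw [← Nat.card_eq_fintype_card, Nat.card_congr (MulAction.selfEquivSigmaOrbits Q α),
      Nat.card_sigma]
  exact pow_succ_padicValNat_not_dvd (p := 2) (n := Fintype.card α) Fintype.card_ne_zero
    ((Finset.dvd_sum fun ω _ => hdvd ω.out).trans hsum.symm.dvd)

theorem minFaithfulDim_of_ne_two_pow {k L α C G : Type*} [Field k] [Field L] [Algebra k L]
    [FiniteDimensional k L] [Fintype α] [DecidableEq α] [Nonempty α] [CommGroup C] [Group G]
    (Q : Sylow 2 (Equiv.Perm α)) {π : Monomial C (Q : Subgroup (Equiv.Perm α)) →* G}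
    (hsurj : Function.Surjective π)
    (hπ : ∀ h, π h = 1 ↔ h.right = 1 ∧ ∀ x y, h.left x = h.left y) {j : C →* Lˣ}
    (hj : Function.Injective j) {c : C} {m : ℕ} (hc : c ^ 2 ^ (m + 1) = 1) (hc' : c ^ 2 ^ m ≠ 1)
    (h2 : (2 : L) ≠ 0) {ζ : L} (hζ : IsPrimitiveRoot ζ (2 ^ (m + 1)))
    (hgen : ∀ ζ : L, ζ ^ 2 ^ m = -1 → ∀ γ : L ≃ₐ[k] L, γ ζ = ζ → γ = 1)
    (hL : Nat.card (L ≃ₐ[k] L) = Module.finrank k L)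
    (hα : ∀ t : ℕ, Fintype.card α ≠ 2 ^ t) :
    minFaithfulDim k G = 2 ^ padicValNat 2 (Fintype.card α) *
      (Fintype.card α - 2 ^ padicValNat 2 (Fintype.card α)) * Module.finrank k L := by
  classical
  obtain ⟨x₀, hx₀⟩ := exists_card_orbit_eq Q
  refine minFaithfulDim_eq ?_ fun d φ hφ => ?_
  · let A : Finset α := Finset.univ.filter fun x => x ∈ MulAction.orbit Q x₀
    have hA : ∀ x, x ∈ A ↔ x ∈ MulAction.orbit Q x₀ := by simp [A]
    have hcA : A.card = 2 ^ padicValNat 2 (Fintype.card α) := by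
      have : (A : Set α) = MulAction.orbit Q x₀ := by ext; simp [A]
      rw [← hx₀, ← Set.ncard_coe_finset, this]
      rfl
    have hAinv : ∀ g ∈ Q, ∀ x, g x ∈ A ↔ x ∈ A := by
      intro g hg x
      rw [hA, hA]
      rw [← MulAction.orbit_eq_iff, ← MulAction.orbit_eq_iff]
      exact Eq.congr_left (MulAction.orbit_smul (⟨g, hg⟩ : Q) x)
    rw [← hcA, ← Finset.card_compl, ← Finset.card_product]
    refine exists_injective_of_invariant k hsurj hπ hj (fun g hg x y hxy => ?_) A
      ⟨x₀, (hA _).2 (MulAction.mem_orbit_self x₀)⟩ ?_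
      fun x hx y hy => Finset.mk_mem_product hx (Finset.mem_compl.2 hy)
    · rw [Finset.mem_product, Finset.mem_compl] at hxy ⊢
      rwa [hAinv g hg, hAinv g hg]
    · by_contra! h
      rw [← Finset.eq_univ_iff_forall] at h
      rw [h, Finset.card_univ] at hcA
      exact hα _ hcA
  · obtain ⟨Λ, hΛ, hcard⟩ := exists_isWeightSet hπ hc hc' h2 hζ hφ
    have := card_weights_ge_of_orbit (fun h => h2 (by linear_combination -h)) hgen Q Λ hΛ x₀
      (fun x => by
        rw [hx₀]
        have : Nonempty (MulAction.orbit Q x) := ⟨⟨x, MulAction.mem_orbit_self x⟩⟩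
        exact Nat.le_of_dvd Nat.card_pos (sylow_orbit_dvd Q x))
    rw [hL, hx₀, mul_comm] at this
    exact this.trans hcard

theorem minFaithfulDim_of_two_pow {k L α C G : Type*} [Field k] [Field L] [Algebra k L]
    [FiniteDimensional k L] [Fintype α] [DecidableEq α] [CommGroup C] [Group G]
    (Q : Sylow 2 (Equiv.Perm α)) {π : Monomial C (Q : Subgroup (Equiv.Perm α)) →* G}
    (hsurj : Function.Surjective π)
    (hπ : ∀ h, π h = 1 ↔ h.right = 1 ∧ ∀ x y, h.left x = h.left y) {j : C →* Lˣ}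
    (hj : Function.Injective j) {c : C} {m : ℕ} (hc : c ^ 2 ^ (m + 1) = 1) (hc' : c ^ 2 ^ m ≠ 1)
    (h2 : (2 : L) ≠ 0) {ζ : L} (hζ : IsPrimitiveRoot ζ (2 ^ (m + 1)))
    (hgen : ∀ ζ : L, ζ ^ 2 ^ m = -1 → ∀ γ : L ≃ₐ[k] L, γ ζ = ζ → γ = 1)
    (hL : Nat.card (L ≃ₐ[k] L) = Module.finrank k L) (t : ℕ)
    (hα : Fintype.card α = 2 ^ (t + 1)) :
    (∀ σ : L ≃ₐ[k] L, (∀ a, σ (σ a) = a) → σ ≠ 1 → (∀ c, σ (j c) = (j c⁻¹ : Lˣ)) →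
      minFaithfulDim k G = 2 ^ (2 * t) * Module.finrank k L) ∧
    ((∀ ζ : L, ζ ^ 2 ^ m = -1 → ∀ γ : L ≃ₐ[k] L, γ ζ ≠ ζ⁻¹) →
      minFaithfulDim k G = 2 ^ (2 * t + 1) * Module.finrank k L) := by
  have h2' : (-1 : L) ≠ 1 := fun h => h2 (by linear_combination -h)
  obtain ⟨A, K, -, hKA, hQA, -, -, hcA, hcA'⟩ := exists_halves Q t hα
  have hA : A.Nonempty := Finset.card_pos.1 (by rw [hcA]; positivity)
  have hA' : ∃ y, y ∉ A := by
    obtain ⟨y, hy⟩ : Aᶜ.Nonempty := Finset.card_pos.1 (by rw [hcA']; positivity)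
    exact ⟨y, Finset.mem_compl.1 hy⟩
  have hQ : ∀ g ∈ Q, (∀ x, g x ∈ A ↔ x ∈ A) ∨ ∀ x, g x ∈ A ↔ x ∉ A := by
    intro g hg
    by_cases hgK : g ∈ K
    · exact Or.inl (hKA g hgK)
    · exact Or.inr (hQA g hg hgK)
  constructor
  · intro σ hσ hσ1 hσj
    refine minFaithfulDim_eq ?_ fun d φ hφ => ?_
    · have := exists_injective_of_involution hsurj hπ hj A hA hA' hQ σ hσ hσ1 hσj
      rwa [hcA, hcA', ← pow_add, ← two_mul] at this
    · obtain ⟨Λ, hΛ, hcard⟩ := exists_isWeightSet hπ hc hc' h2 hζ hφ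
      have := (card_weights_ge_of_halves h2' hgen Q Λ hΛ t hα).1
      rw [hL, mul_comm] at this
      exact this.trans hcard
  · intro hno
    refine minFaithfulDim_eq ?_ fun d φ hφ => ?_
    · have := exists_injective_of_invariant (k := k) hsurj hπ hj (E := A ×ˢ Aᶜ ∪ Aᶜ ×ˢ A)
        (fun g hg x y hxy => by
          simp only [Finset.mem_union, Finset.mem_product, Finset.mem_compl] at hxy ⊢
          rcases hQ g hg with h | h
          · rwa [h, h]
          · rw [h, h]
            tauto) A hA hA' fun x hx y hy =>
          Finset.mem_union_left _ (Finset.mk_mem_product hx (Finset.mem_compl.2 hy))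
      have hE : (A ×ˢ Aᶜ ∪ Aᶜ ×ˢ A).card = 2 ^ (2 * t + 1) := by
        rw [Finset.card_union_of_disjoint, Finset.card_product, Finset.card_product, hcA, hcA']
        · ring
        · exact Finset.disjoint_product.2 (Or.inl disjoint_compl_right)
      rwa [hE] at this
    · obtain ⟨Λ, hΛ, hcard⟩ := exists_isWeightSet hπ hc hc' h2 hζ hφ
      have := (card_weights_ge_of_halves h2' hgen Q Λ hΛ t hα).2 hno
      rw [hL, mul_comm] at this
      exact this.trans hcard

theorem algEquiv_ext_of_gen {k K : Type*} [Field k] [Field K] [Algebra k K] {ε : K}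
    (hε : IsIntegral k ε) {γ γ' : k⟮ε⟯ ≃ₐ[k] k⟮ε⟯}
    (h : γ (AdjoinSimple.gen k ε) = γ' (AdjoinSimple.gen k ε)) : γ = γ' := by
  have : γ.toAlgHom = γ'.toAlgHom :=
    (IntermediateField.adjoin.powerBasis hε).algHom_ext
      (by rw [IntermediateField.adjoin.powerBasis_gen]; exact h)
  exact AlgEquiv.ext fun a => DFunLike.congr_fun this a

/-- Any primitive `2 ^ (m + 1)`-th root of unity has every other one as a power. -/
theorem exists_pow_eq_of_pow_eq_neg_one {L : Type*} [Field L] (h2 : (2 : L) ≠ 0) {m : ℕ} {e ζ : L}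
    (he : e ^ 2 ^ (m + 1) = 1) (hζ : ζ ^ 2 ^ m = -1) : ∃ i : ℕ, ζ ^ i = e := by
  have hprim : IsPrimitiveRoot ζ (2 ^ (m + 1)) := by
    rw [IsPrimitiveRoot.iff_orderOf]
    refine orderOf_eq_prime_pow ?_ (by rw [pow_succ, pow_mul, hζ, neg_one_sq])
    intro h
    rw [hζ] at h
    exact h2 (by linear_combination -h)
  obtain ⟨i, -, hi⟩ := hprim.eq_pow_of_pow_eq_one he
  exact ⟨i, hi⟩

theorem card_algEquiv_adjoin {k K : Type*} [Field k] [Field K] [Algebra k K] [Algebra.IsIntegral k K]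
    {ε : K} {N : ℕ}
    (hN : N ≠ 0) (hε : IsPrimitiveRoot ε N) :
    Nat.card (k⟮ε⟯ ≃ₐ[k] k⟮ε⟯) = Module.finrank k k⟮ε⟯ := by
  have : NeZero N := ⟨hN⟩
  have hcyc := hε.intermediateField_adjoin_isCyclotomicExtension k
  have : IsGalois k k⟮ε⟯ := IsCyclotomicExtension.isGalois {N} k k⟮ε⟯
  have : FiniteDimensional k k⟮ε⟯ := IsCyclotomicExtension.finiteDimensional {N} k k⟮ε⟯
  exact IsGalois.card_aut_eq_finrank k k⟮ε⟯

theorem exists_orderOf_units_eq (F : Type*) [Field F] [Fintype F] {N : ℕ}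
    (hN : N ∣ Fintype.card F - 1) : ∃ x : Fˣ, orderOf x = N := by
  obtain ⟨g, hg⟩ := IsCyclic.exists_ofOrder_eq_natCard (α := Fˣ)
  rw [Nat.card_units, Nat.card_eq_fintype_card] at hg
  have hpos : Fintype.card F - 1 ≠ 0 := Nat.sub_ne_zero_of_lt Fintype.one_lt_card
  obtain ⟨M, hM⟩ := hN
  have hM0 : M ≠ 0 := by
    rintro rfl
    exact hpos (by rw [hM, mul_zero])
  refine ⟨g ^ M, ?_⟩
  rw [orderOf_pow_of_dvd hM0 (by rw [hg, hM]; exact dvd_mul_left _ _), hg, hM,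
    Nat.mul_div_cancel _ (Nat.pos_of_ne_zero hM0)]

end SylowPGL

theorem stmt3 (p r q s : ℕ) (hp : p.Prime) (hodd : p ≠ 2) (hr : 1 ≤ r)
    (hq : q = p ^ r) (hq4 : q % 4 = 1) (hs : s = padicValNat 2 (q - 1))
    (k : Type*) [Field k] (hchar : ringChar k ≠ 2)
    (ε : AlgebraicClosure k) (hε : IsPrimitiveRoot ε (2 ^ s))
    (F : Type*) [Field F] [Fintype F] (hF : Fintype.card F = q)
    (n : ℕ) (hn : 2 ≤ n)
    (P : Sylow 2 (Matrix.GeneralLinearGroup (Fin n) F ⧸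
      Subgroup.center (Matrix.GeneralLinearGroup (Fin n) F))) :
    (Odd n →
      minFaithfulDim k ↥P =
        (n - 1) * Module.finrank k (IntermediateField.adjoin k {ε})) ∧
    (Even n → (∀ t : ℕ, n ≠ 2 ^ t) →
      minFaithfulDim k ↥P =
        2 ^ padicValNat 2 n * (n - 2 ^ padicValNat 2 n) *
          Module.finrank k (IntermediateField.adjoin k {ε})) ∧
    (∀ t : ℕ, n = 2 ^ t →
      ((∃ σ : k⟮ε⟯ ≃ₐ[k] k⟮ε⟯, σ (AdjoinSimple.gen k ε) = (AdjoinSimple.gen k ε)⁻¹) →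
        minFaithfulDim k ↥P =
          2 ^ (2 * t - 2) * Module.finrank k (IntermediateField.adjoin k {ε})) ∧
      (¬ (∃ σ : k⟮ε⟯ ≃ₐ[k] k⟮ε⟯, σ (AdjoinSimple.gen k ε) = (AdjoinSimple.gen k ε)⁻¹) →
        minFaithfulDim k ↥P =
          2 ^ (2 * t - 1) * Module.finrank k (IntermediateField.adjoin k {ε}))) := by
  have hq1 : 1 < q := by
    rw [hq]
    exact Nat.one_lt_pow (by omega) hp.one_lt
  obtain ⟨m, rfl, hm⟩ : ∃ m, s = m + 1 ∧ 1 ≤ m := by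
    have h : 2 ≤ s := by
      rw [hs]
      exact (padicValNat_dvd_iff_le (by omega)).1 (by omega)
    exact ⟨s - 1, by omega, by omega⟩
  set e : k⟮ε⟯ := AdjoinSimple.gen k ε with he_def
  have he : IsPrimitiveRoot e (2 ^ (m + 1)) :=
    IsPrimitiveRoot.of_map_of_injective (f := algebraMap k⟮ε⟯ (AlgebraicClosure k))
      (by rwa [he_def, AdjoinSimple.algebraMap_gen]) (algebraMap k⟮ε⟯ (AlgebraicClosure k)).injective
  have hεint : IsIntegral k ε := Algebra.IsIntegral.isIntegral ε
  have : FiniteDimensional k k⟮ε⟯ := adjoin.finiteDimensional hεint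
  have h2 : (2 : k⟮ε⟯) ≠ 0 := by
    have := (map_ne_zero (algebraMap k k⟮ε⟯)).2 (Ring.two_ne_zero hchar)
    rwa [map_ofNat] at this
  have hL := SylowPGL.card_algEquiv_adjoin (k := k) (by positivity) hε
  have hgen : ∀ ζ : k⟮ε⟯, ζ ^ 2 ^ m = -1 → ∀ γ : k⟮ε⟯ ≃ₐ[k] k⟮ε⟯, γ ζ = ζ → γ = 1 := by
    intro ζ hζ γ hγ
    obtain ⟨i, hi⟩ := SylowPGL.exists_pow_eq_of_pow_eq_neg_one h2 he.pow_eq_one hζ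
    refine SylowPGL.algEquiv_ext_of_gen hεint ?_
    rw [← he_def, ← hi, map_pow, hγ, map_pow, AlgEquiv.one_apply]
  obtain ⟨x, hx⟩ := SylowPGL.exists_orderOf_units_eq F (N := 2 ^ (m + 1))
    (by rw [hF, hs]; exact pow_padicValNat_dvd)
  let u : (k⟮ε⟯)ˣ := (he.isUnit (by positivity)).unit
  have hu : orderOf u = 2 ^ (m + 1) := by
    rw [← orderOf_units]
    exact he.eq_orderOf.symm
  let C := Subgroup.zpowers x
  have hC : Nat.card C = 2 ^ (m + 1) := by rw [Nat.card_zpowers, hx]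
  have : Finite C := Nat.finite_of_card_ne_zero (by rw [hC]; positivity)
  let i : C ≃* Subgroup.zpowers u := mulEquivOfCyclicCardEq (by rw [hC, Nat.card_zpowers, hu])
  let j : C →* (k⟮ε⟯)ˣ := (Subgroup.zpowers u).subtype.comp i.toMonoidHom
  have hj : Function.Injective j := Subtype.val_injective.comp i.injective
  let c : C := ⟨x, Subgroup.mem_zpowers x⟩
  have hc : orderOf c = 2 ^ (m + 1) := by rw [← hx, Subgroup.orderOf_mk]
  have hc1 : c ^ 2 ^ (m + 1) = 1 := by rw [← hc, pow_orderOf_eq_one]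
  have hc2 : c ^ 2 ^ m ≠ 1 := by
    refine pow_ne_one_of_lt_orderOf (by positivity) ?_
    rw [hc]
    exact Nat.pow_lt_pow_right (by norm_num) (by omega)
  obtain ⟨Q⟩ : Nonempty (Sylow 2 (Equiv.Perm (Fin n))) := inferInstance
  have : Nonempty (Fin n) := ⟨⟨0, by omega⟩⟩
  obtain ⟨π, hsurj, hπ⟩ := SylowPGL.exists_surjective_monomial (by omega) hq4 hq1 hs hF P hC
    (j := C.subtype) Subtype.val_injective Q
  have hmain : (∀ t : ℕ, n ≠ 2 ^ t) → minFaithfulDim k ↥P =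
      2 ^ padicValNat 2 n * (n - 2 ^ padicValNat 2 n) * Module.finrank k k⟮ε⟯ := by
    intro hn2
    have h := SylowPGL.minFaithfulDim_of_ne_two_pow Q hsurj hπ hj hc1 hc2 h2 he hgen hL
      (by rwa [Fintype.card_fin])
    rw [Fintype.card_fin] at h
    exact h
  refine ⟨fun hnodd => ?_, fun _ => hmain, fun t ht => ?_⟩
  · have hv : padicValNat 2 n = 0 := padicValNat.eq_zero_of_not_dvd (by
      rw [← even_iff_two_dvd, Nat.not_even_iff_odd]
      exact hnodd)
    rw [hmain ?_, hv, pow_zero, one_mul]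
    rintro t rfl
    rcases Nat.eq_zero_or_pos t with rfl | ht
    · omega
    · exact (Nat.not_even_iff_odd.2 hnodd) (even_two.pow_of_ne_zero ht.ne')
  · obtain ⟨t, rfl⟩ : ∃ t', t = t' + 1 := Nat.exists_eq_succ_of_ne_zero (by
      rintro rfl
      omega)
    obtain ⟨hinv, hno⟩ := SylowPGL.minFaithfulDim_of_two_pow Q hsurj hπ hj hc1 hc2 h2 he hgen hL t
      (by rw [Fintype.card_fin, ht])
    constructor
    · rintro ⟨σ, hσ⟩
      have hσσ : σ (σ e) = e := by rw [hσ, map_inv₀, hσ, inv_inv]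
      have hσ2 : σ * σ = 1 := SylowPGL.algEquiv_ext_of_gen hεint hσσ
      refine hinv σ (fun a => DFunLike.congr_fun hσ2 a) ?_ fun c => ?_
      · rintro rfl
        rw [AlgEquiv.one_apply] at hσ
        have h1 : e ^ 2 = 1 := by
          rw [sq]
          nth_rewrite 2 [hσ]
          exact mul_inv_cancel₀ (he.ne_zero (by positivity))
        have h3 := Nat.le_of_dvd (by norm_num) (he.dvd_of_pow_eq_one 2 h1)
        have h4 := Nat.pow_le_pow_right (n := 2) (by norm_num) (Nat.succ_le_succ hm)
        omega
      · obtain ⟨z, hz⟩ := Subgroup.mem_zpowers_iff.1 (i c).2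
        have hjc : j c = u ^ z := hz.symm
        have hue : (u : k⟮ε⟯) = e := rfl
        rw [map_inv, hjc, Units.val_inv_eq_inv_val, Units.val_zpow_eq_zpow_val, hue, map_zpow₀, hσ,
          inv_zpow]
    · intro hσ
      refine hno fun ζ hζ γ hγ => hσ ⟨γ, ?_⟩
      obtain ⟨i, hi⟩ := SylowPGL.exists_pow_eq_of_pow_eq_neg_one h2 he.pow_eq_one hζ
      rw [← hi, map_pow, hγ, inv_pow]
end

section
/- Let p be an odd prime, q = p^r with q ≡ 3 (mod 4), and s = v₂(q+1)+1. Let SD denote the semidihedral group of order 2^{s+1}, i.e. the semidirect product C_{2^s} ⋊ C₂ in which the nontrivial element of C₂ acts on the cyclic group C_{2^s} = ⟨x⟩ of order 2^s by x ↦ x^{2^{s−1}−1}. Then for every m ≥ 1: every Sylow 2-subgroup of GL_{2m}(F_q) is isomorphic to SD^m ⋊ Q, where Q is a Sylow 2-subgroup of the symmetric group S_m acting on the m-fold direct product SD^m by permuting the factors; and every Sylow 2-subgroup of GL_{2m+1}(F_q) is isomorphic to (SD^m ⋊ Q) × C₂. -/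
/-- The action of permutations on `m`-tuples in a group `C` by permuting the
coordinates: `(σ • f) i = f (σ⁻¹ i)`. -/
def permAction (m : ℕ) (C : Type*) [Group C] :
    Equiv.Perm (Fin m) →* MulAut (Fin m → C) :=
  MonoidHom.mk'
    (fun σ =>
      { toFun := fun f => f ∘ σ.symm
        invFun := fun f => f ∘ σ
        left_inv := fun f => by ext i; simp
        right_inv := fun f => by ext i; simp
        map_mul' := fun f g => rfl })
    (fun σ τ => by ext f i; simp [Equiv.Perm.mul_def])

theorem Sylow.nonempty_mulEquiv_of_injective {p : ℕ} [Fact p.Prime] {G H : Type*} [Group G]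
    [Group H] [Finite G] (f : H →* G) (hf : Function.Injective f)
    (hcard : Nat.card H = p ^ (Nat.card G).factorization p) (P : Sylow p G) :
    Nonempty (P ≃* H) := by
  have e : H ≃* f.range := f.ofInjective hf
  exact ⟨(P.equiv (Sylow.ofCard f.range (by rw [← Nat.card_congr e.toEquiv, hcard]))).trans e.symm⟩

theorem Sylow.nonempty_mulEquiv_of_representation {p n : ℕ} [Fact p.Prime] {F G V : Type*}
    [Field F] [Finite F] [Group G] [AddCommGroup V] [Module F V] [FiniteDimensional F V]
    (ρ : Representation F G V) (hρ : Function.Injective ρ) (hV : Module.finrank F V = n)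
    (hcard : Nat.card G = p ^ (Nat.card (Matrix.GeneralLinearGroup (Fin n) F)).factorization p)
    (P : Sylow p (Matrix.GeneralLinearGroup (Fin n) F)) : Nonempty (P ≃* G) := by
  let e : Matrix.GeneralLinearGroup (Fin n) F ≃* LinearMap.GeneralLinearGroup F V :=
    Matrix.GeneralLinearGroup.toLin' (Module.finBasisOfFinrankEq F V hV)
  refine P.nonempty_mulEquiv_of_injective (e.symm.toMonoidHom.comp ρ.toHomUnits) ?_ hcard
  refine e.symm.injective.comp fun g h hgh ↦ hρ ?_
  simpa using congr_arg Units.val hgh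

/-- The imprimitive representation of a wreath product on `m`-tuples of vectors. -/
def wreathRepresentation {F G V : Type*} [Field F] [Group G] [AddCommGroup V] [Module F V]
    (ρ : Representation F G V) (m : ℕ) (Q : Subgroup (Equiv.Perm (Fin m))) :
    Representation F (SemidirectProduct (Fin m → G) Q ((permAction m G).comp Q.subtype))
      (Fin m → V) where
  toFun w := LinearMap.pi fun i ↦
    (ρ (w.left i)).comp (LinearMap.proj ((w.right : Equiv.Perm (Fin m)).symm i))
  map_one' := LinearMap.ext fun _ ↦ funext fun _ ↦ by simp; rfl
  map_mul' w z := by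
    refine LinearMap.ext fun v ↦ funext fun i ↦ ?_
    change ρ (w.left i * z.left ((w.right : Equiv.Perm (Fin m)).symm i)) _ = _
    rw [map_mul]
    rfl

theorem wreathRepresentation_apply {F G V : Type*} [Field F] [Group G] [AddCommGroup V]
    [Module F V] (ρ : Representation F G V) (m : ℕ) (Q : Subgroup (Equiv.Perm (Fin m)))
    (w : SemidirectProduct (Fin m → G) Q ((permAction m G).comp Q.subtype)) (v : Fin m → V)
    (i : Fin m) : wreathRepresentation ρ m Q w v i =
      ρ (w.left i) (v ((w.right : Equiv.Perm (Fin m)).symm i)) := rfl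

theorem wreathRepresentation_injective {F G V : Type*} [Field F] [Group G] [AddCommGroup V]
    [Module F V] [Nontrivial V] (ρ : Representation F G V) (hρ : Function.Injective ρ) (m : ℕ)
    (Q : Subgroup (Equiv.Perm (Fin m))) : Function.Injective (wreathRepresentation ρ m Q) := by
  rw [injective_iff_map_eq_one]
  intro w hw
  have key (v : Fin m → V) (i : Fin m) :
      ρ (w.left i) (v ((w.right : Equiv.Perm (Fin m)).symm i)) = v i := by
    rw [← wreathRepresentation_apply, hw]; rfl
  obtain ⟨u, hu⟩ := exists_ne (0 : V)
  have hσ (i : Fin m) : (w.right : Equiv.Perm (Fin m)).symm i = i := by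
    by_contra h
    have := key (Pi.single i u) i
    simp [Pi.single_eq_of_ne h] at this
    exact hu this.symm
  refine SemidirectProduct.ext (funext fun i ↦ hρ (LinearMap.ext fun x ↦ ?_)) ?_
  · simpa using key (fun _ ↦ x) i
  · exact Subtype.ext (Equiv.ext fun i ↦ by simpa using (Equiv.symm_apply_eq _).1 (hσ i) |>.symm)

/-- The external direct sum of representations of two groups, as a representation of the product
of the groups. -/
def Representation.externalSum {F G H V W : Type*} [Field F] [Group G] [Group H]
    [AddCommGroup V] [Module F V] [AddCommGroup W] [Module F W]
    (ρ : Representation F G V) (τ : Representation F H W) : Representation F (G × H) (V × W) where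
  toFun g := (ρ g.1).prodMap (τ g.2)
  map_one' := by ext <;> simp
  map_mul' g h := by ext <;> simp

theorem Representation.externalSum_injective {F G H V W : Type*} [Field F] [Group G] [Group H]
    [AddCommGroup V] [Module F V] [AddCommGroup W] [Module F W]
    {ρ : Representation F G V} {τ : Representation F H W} (hρ : Function.Injective ρ)
    (hτ : Function.Injective τ) : Function.Injective (ρ.externalSum τ) := by
  intro g h hgh
  refine Prod.ext (hρ (LinearMap.ext fun v ↦ ?_)) (hτ (LinearMap.ext fun w ↦ ?_))
  · exact congr_arg Prod.fst (LinearMap.congr_fun hgh (v, 0))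
  · exact congr_arg Prod.snd (LinearMap.congr_fun hgh (0, w))

theorem exists_injective_sign_representation (F : Type*) [Field F] (hF : (-1 : F) ≠ 1) :
    ∃ τ : Representation F (Multiplicative (ZMod 2)) F, Function.Injective τ := by
  let e : Multiplicative (ZMod 2) ≃* ℤˣ := mulEquivOfPrimeCardEq (p := 2) (by simp) (by simp)
  let τ : ℤˣ →* Module.End F F :=
    (Int.castRingHom (Module.End F F)).toMonoidHom.comp (Units.coeHom ℤ)
  suffices h : Function.Injective τ from
    ⟨τ.comp e.toMonoidHom, h.comp (g := τ) (f := e) e.injective⟩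
  rw [injective_iff_map_eq_one]
  intro u hu
  refine (Int.units_eq_one_or u).resolve_right ?_
  rintro rfl
  exact hF (by simpa [τ] using LinearMap.congr_fun hu 1)

theorem Subgroup.exists_eq_zpow_or_of_mem_closure_pair {G : Type*} [Group G] {a b : G} {k : ℕ}
    (hb : b ^ 2 = 1) (hab : b * a * b = a ^ k) {g : G} (hg : g ∈ Subgroup.closure {a, b}) :
    ∃ i : ℤ, g = a ^ i ∨ g = a ^ i * b := by
  have hbb : b * b = 1 := by rw [← sq, hb]
  have hbi : b⁻¹ = b := inv_eq_of_mul_eq_one_left hbb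
  have hconj (i : ℤ) : b * a ^ i = a ^ (k * i) * b := by
    have : b * a ^ i * b⁻¹ = a ^ (k * i) := by
      rw [← conj_zpow, hbi, hab, zpow_mul, zpow_natCast]
    rw [← this, inv_mul_cancel_right]
  have hmul (g : G) (h : ∃ i : ℤ, g = a ^ i ∨ g = a ^ i * b) :
      ∃ i : ℤ, b * g = a ^ i ∨ b * g = a ^ i * b := by
    obtain ⟨i, rfl | rfl⟩ := h
    · exact ⟨k * i, .inr (hconj i)⟩
    · exact ⟨k * i, .inl (by rw [← mul_assoc, hconj, mul_assoc, hbb, mul_one])⟩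
  induction hg using Subgroup.closure_induction_left with
  | one => exact ⟨0, .inl (by simp)⟩
  | mul_left x hx y _ h =>
    rcases hx with rfl | rfl
    · obtain ⟨i, rfl | rfl⟩ := h
      · exact ⟨1 + i, .inl (by rw [zpow_one_add])⟩
      · exact ⟨1 + i, .inr (by rw [zpow_one_add, mul_assoc])⟩
    · exact hmul y h
  | inv_mul_cancel x hx y _ h =>
    rcases hx with rfl | rfl
    · obtain ⟨i, rfl | rfl⟩ := h
      · exact ⟨-1 + i, .inl (by rw [zpow_add, zpow_neg_one])⟩
      · exact ⟨-1 + i, .inr (by rw [zpow_add, zpow_neg_one, mul_assoc])⟩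
    · rw [hbi]; exact hmul y h

theorem exists_monoidHom_of_relations {G H : Type*} [Group G] [Group H] {a b : G} {c d : H}
    {k : ℕ} (hb : b ^ 2 = 1) (hab : b * a * b = a ^ k) (hgen : Subgroup.closure {a, b} = ⊤)
    (hmem : b ∉ Subgroup.zpowers a) (hc : c ^ orderOf a = 1) (hd : d ^ 2 = 1)
    (hcd : d * c * d = c ^ k) : ∃ φ : G →* H, φ a = c ∧ φ b = d := by
  let Γ : Subgroup (G × H) := Subgroup.closure {(a, c), (b, d)}
  let π : Γ →* G := (MonoidHom.fst G H).comp Γ.subtype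
  have hinj : Function.Injective π := by
    rw [injective_iff_map_eq_one]
    rintro ⟨g, hg⟩ h1
    obtain ⟨i, hi⟩ := Subgroup.exists_eq_zpow_or_of_mem_closure_pair (k := k)
      (Prod.ext hb hd) (Prod.ext hab hcd) hg
    rcases hi with rfl | rfl
    · have ha : a ^ i = 1 := h1
      obtain ⟨j, rfl⟩ := orderOf_dvd_iff_zpow_eq_one.2 ha
      refine Subtype.ext (Prod.ext ha ?_)
      change c ^ ((orderOf a : ℤ) * j) = 1
      rw [zpow_mul, zpow_natCast, hc, one_zpow]
    · have ha : a ^ i * b = 1 := h1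
      exact absurd ⟨-i, by simpa using inv_eq_of_mul_eq_one_right ha⟩ hmem
  have hsurj : Function.Surjective π := by
    rw [← MonoidHom.range_eq_top, eq_top_iff, ← hgen, Subgroup.closure_le]
    rintro g (rfl | rfl)
    · exact ⟨⟨_, Subgroup.subset_closure (.inl rfl)⟩, rfl⟩
    · exact ⟨⟨_, Subgroup.subset_closure (.inr rfl)⟩, rfl⟩
  let e : Γ ≃* G := MulEquiv.ofBijective π ⟨hinj, hsurj⟩
  have hlift (z : Γ) : e.symm (π z) = z := e.symm_apply_apply z
  refine ⟨((MonoidHom.snd G H).comp Γ.subtype).comp e.symm.toMonoidHom, ?_, ?_⟩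
  · exact congr_arg (fun z : Γ ↦ z.1.2) (hlift ⟨(a, c), Subgroup.subset_closure (.inl rfl)⟩)
  · exact congr_arg (fun z : Γ ↦ z.1.2) (hlift ⟨(b, d), Subgroup.subset_closure (.inr rfl)⟩)

theorem padicValNat_two_pow_sub_one_of_odd {q k : ℕ} (hq : q % 4 = 3) (hk : Odd k) :
    padicValNat 2 (q ^ k - 1) = 1 := by
  have h : q ^ k % 4 = 3 := by
    obtain ⟨j, rfl⟩ := hk
    have : q ^ 2 % 4 = 1 := by simp [Nat.pow_mod, hq]
    rw [pow_succ, pow_mul, Nat.mul_mod, Nat.pow_mod, this, hq]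
    simp
  obtain ⟨t, ht⟩ : ∃ t, q ^ k - 1 = 2 * (2 * t + 1) := ⟨q ^ k / 4, by lia⟩
  rw [ht, padicValNat.mul (by simp) (by simp), padicValNat.self (by simp),
    padicValNat.eq_zero_of_not_dvd (by lia)]

theorem padicValNat_two_pow_sub_one_of_even {q j : ℕ} (hq : q % 4 = 3) (hj : j ≠ 0) :
    padicValNat 2 (q ^ (2 * j) - 1) = padicValNat 2 (q + 1) + 1 + padicValNat 2 j := by
  have h := padicValNat.pow_two_sub_pow (x := q) (y := 1) (by lia) (by lia) (by lia)
    (n := 2 * j) (by simpa using hj) (by simp)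
  have h1 := padicValNat_two_pow_sub_one_of_odd hq odd_one
  rw [pow_one] at h1
  rw [one_pow, padicValNat.mul two_ne_zero hj, padicValNat.self (by simp), h1] at h
  lia

theorem factorization_card_GL_two {F : Type*} [Field F] [Fintype F]
    (hF : Odd (Fintype.card F)) (n : ℕ) :
    (Nat.card (Matrix.GeneralLinearGroup (Fin n) F)).factorization 2 =
      ∑ k ∈ Finset.range n, padicValNat 2 (Fintype.card F ^ (k + 1) - 1) := by
  have hq : 1 < Fintype.card F := Fintype.one_lt_card
  have hpos (k : ℕ) : Fintype.card F ^ (k + 1) - 1 ≠ 0 :=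
    Nat.sub_ne_zero_of_lt (Nat.one_lt_pow (by simp) hq)
  have hprod : Nat.card (Matrix.GeneralLinearGroup (Fin n) F) =
      ∏ k ∈ Finset.range n, Fintype.card F ^ (n - 1 - k) * (Fintype.card F ^ (k + 1) - 1) := by
    rw [Matrix.card_GL_field,
      Fin.prod_univ_eq_prod_range (fun i ↦ Fintype.card F ^ n - Fintype.card F ^ i),
      ← Finset.prod_range_reflect]
    refine Finset.prod_congr rfl fun k hk ↦ ?_
    have := Finset.mem_range.1 hk
    rw [Nat.mul_sub, ← pow_add, mul_one]
    congr 2; lia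
  rw [hprod, Nat.factorization_prod fun k _ ↦ mul_ne_zero (by positivity) (hpos k),
    Finset.sum_apply']
  refine Finset.sum_congr rfl fun k _ ↦ ?_
  rw [Nat.factorization_def _ Nat.prime_two, padicValNat.mul (by positivity) (hpos k),
    padicValNat.eq_zero_of_not_dvd, zero_add]
  rw [← even_iff_two_dvd, Nat.not_even_iff_odd]
  exact hF.pow

theorem sum_padicValNat_two_pow_sub_one {q : ℕ} (hq : q % 4 = 3) (m : ℕ) :
    ∑ k ∈ Finset.range (2 * m), padicValNat 2 (q ^ (k + 1) - 1) =
      (padicValNat 2 (q + 1) + 2) * m + padicValNat 2 m.factorial := by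
  induction m with
  | zero => simp
  | succ m ih =>
    rw [Nat.mul_succ, Finset.sum_range_succ, Finset.sum_range_succ, ih,
      padicValNat_two_pow_sub_one_of_odd hq ⟨m, rfl⟩, Nat.factorial_succ,
      padicValNat.mul m.succ_ne_zero m.factorial_ne_zero,
      show 2 * m + 1 + 1 = 2 * (m + 1) by ring,
      padicValNat_two_pow_sub_one_of_even hq m.succ_ne_zero]
    ring

theorem exists_injective_semidihedral_representation (F : Type*) [Field F] [Fintype F] (p : ℕ)
    [Fact p.Prime] [CharP F p] {SD : Type*} [Group SD] {x y : SD} {s : ℕ}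
    (hq4 : Fintype.card F % 4 = 3) (hs : s = padicValNat 2 (Fintype.card F + 1) + 1)
    (hcard : Nat.card SD = 2 ^ (s + 1)) (hx : orderOf x = 2 ^ s) (hy : y ^ 2 = 1)
    (hxy : y * x * y = x ^ (2 ^ (s - 1) - 1)) (hgen : Subgroup.closure {x, y} = ⊤) :
    ∃ ρ : Representation F SD (FiniteField.Extension F p 2), Function.Injective ρ := by
  let K := FiniteField.Extension F p 2
  have hK : Nat.card K = Fintype.card F ^ 2 := by
    rw [FiniteField.natCard_extension, Nat.card_eq_fintype_card]
  have hq : 1 < Fintype.card F := Fintype.one_lt_card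
  obtain ⟨ζ, hζ⟩ : ∃ ζ : Kˣ, orderOf ζ = 2 ^ s := by
    obtain ⟨g, hg⟩ := IsCyclic.exists_ofOrder_eq_natCard (α := Kˣ)
    rw [Nat.card_units, hK] at hg
    have hdvd : 2 ^ s ∣ orderOf g := by
      have h := padicValNat_two_pow_sub_one_of_even hq4 one_ne_zero
      rw [padicValNat_one_right, add_zero, ← hs, mul_one] at h
      rw [hg, ← h]
      exact pow_padicValNat_dvd
    exact ⟨g ^ (orderOf g / 2 ^ s), orderOf_pow_orderOf_div (orderOf_pos g).ne' hdvd⟩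
  have hζq : ζ ^ Fintype.card F = ζ ^ (2 ^ (s - 1) - 1) := by
    obtain ⟨u, hu⟩ : 2 ^ (s - 1) ∣ Fintype.card F + 1 := by
      rw [hs, Nat.add_sub_cancel]
      exact pow_padicValNat_dvd
    have hodd : ¬ 2 ∣ u := fun ⟨t, ht⟩ ↦ by
      refine pow_succ_padicValNat_not_dvd (p := 2) (Nat.succ_ne_zero (Fintype.card F)) ⟨t, ?_⟩
      rw [← hs, Nat.succ_eq_add_one, hu, ht, ← mul_assoc, ← pow_succ, Nat.sub_add_cancel (by lia)]
    obtain ⟨t, rfl⟩ : ∃ t, u = 2 * t + 1 := ⟨u / 2, by lia⟩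
    have hpow : 2 ^ s = 2 ^ (s - 1) * 2 := by rw [← pow_succ, Nat.sub_add_cancel (by lia)]
    have h : Fintype.card F = 2 ^ s * t + (2 ^ (s - 1) - 1) := by
      have := Nat.one_le_two_pow (n := s - 1)
      rw [hpow, mul_assoc]
      lia
    rw [h, pow_add, pow_mul, ← hζ, pow_orderOf_eq_one, one_pow, one_mul]
  let frob : Module.End F K := (FiniteField.frobeniusAlgHom F K).toLinearMap
  have hfrob (a : K) : frob a = a ^ Fintype.card F := rfl
  have hfrob2 : frob * frob = 1 := LinearMap.ext fun a ↦ by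
    have := Fintype.ofFinite K
    rw [Module.End.mul_apply, hfrob, hfrob, ← pow_mul, ← sq, ← hK, Nat.card_eq_fintype_card,
      FiniteField.pow_card, Module.End.one_apply]
  let Y : (Module.End F K)ˣ := ⟨frob, frob, hfrob2, hfrob2⟩
  let M : Kˣ →* (Module.End F K)ˣ := Units.map (Algebra.lmul F K).toMonoidHom
  have hM (u : Kˣ) (a : K) : (M u : Module.End F K) a = u * a := rfl
  have hY (a : K) : (Y : Module.End F K) a = a ^ Fintype.card F := rfl
  have hmem : y ∉ Subgroup.zpowers x := fun h ↦ by
    have htop : Subgroup.zpowers x = ⊤ := by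
      rw [eq_top_iff, ← hgen, Subgroup.closure_le]
      rintro g (rfl | rfl)
      exacts [Subgroup.mem_zpowers _, h]
    have := Nat.card_zpowers x
    rw [htop, Subgroup.card_top, hcard, hx] at this
    exact absurd (Nat.pow_right_injective le_rfl this) (by lia)
  obtain ⟨φ, hφx, hφy⟩ := exists_monoidHom_of_relations (c := M ζ) (d := Y) hy hxy hgen hmem
    (by rw [hx, ← hζ, ← map_pow, pow_orderOf_eq_one, map_one]) (Units.ext hfrob2) <| by
      rw [← map_pow, ← hζq]
      refine Units.ext (LinearMap.ext fun a ↦ ?_)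
      change (Y : Module.End F K) ((M ζ : Module.End F K) ((Y : Module.End F K) a)) = _
      have h2 : (a ^ Fintype.card F) ^ Fintype.card F = a := LinearMap.congr_fun hfrob2 a
      rw [hM, hM, hY, hY, mul_pow, h2, Units.val_pow_eq_pow_val]
  refine ⟨(Units.coeHom _).comp φ, ?_⟩
  refine Units.val_injective.comp ((injective_iff_map_eq_one φ).2 fun g hg ↦ ?_)
  have hone (i : ℤ) (h : (ζ ^ i : Kˣ) = 1) : x ^ i = 1 := by
    rw [← orderOf_dvd_iff_zpow_eq_one] at h ⊢
    rwa [hx, ← hζ]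
  obtain ⟨i, rfl | rfl⟩ := Subgroup.exists_eq_zpow_or_of_mem_closure_pair hy hxy
    (hgen ▸ Subgroup.mem_top g)
  · refine hone i (Units.ext ?_)
    rw [map_zpow, hφx, ← map_zpow] at hg
    have h1 : ((ζ ^ i : Kˣ) : K) * 1 = 1 :=
      congr_arg (fun u : (Module.End F K)ˣ ↦ (u : Module.End F K) 1) hg
    rwa [mul_one] at h1
  · rw [map_mul, map_zpow, hφx, hφy, ← map_zpow] at hg
    have key (a : K) : ((ζ ^ i : Kˣ) : K) * a ^ Fintype.card F = a :=
      congr_arg (fun u : (Module.End F K)ˣ ↦ (u : Module.End F K) a) hg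
    have h1 : ((ζ ^ i : Kˣ) : K) = 1 := by simpa using key 1
    have hfix (a : K) : a ^ Fintype.card F = a := by simpa [h1] using key a
    have hdvd : Nat.card Kˣ ∣ Fintype.card F - 1 := by
      obtain ⟨g, hg⟩ := IsCyclic.exists_ofOrder_eq_natCard (α := Kˣ)
      rw [← hg, orderOf_dvd_iff_pow_eq_one]
      refine Units.ext (mul_right_cancel₀ g.ne_zero ?_)
      rw [Units.val_pow_eq_pow_val, ← pow_succ, Nat.sub_add_cancel hq.le, hfix, Units.val_one,
        one_mul]
    rw [Nat.card_units, hK, sq] at hdvd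
    have := Nat.le_of_dvd (by lia) hdvd
    have : Fintype.card F * 1 < Fintype.card F * Fintype.card F := by gcongr
    lia

theorem card_wreath {G : Type*} [Group G] (m : ℕ) (Q : Sylow 2 (Equiv.Perm (Fin m))) :
    Nat.card (SemidirectProduct (Fin m → G) Q
      ((permAction m G).comp (Q : Subgroup (Equiv.Perm (Fin m))).subtype)) =
      Nat.card G ^ m * 2 ^ padicValNat 2 m.factorial := by
  rw [SemidirectProduct.card, Nat.card_fun, Q.card_eq_multiplicity, Nat.card_perm,
    Nat.card_fin, Nat.factorization_def _ Nat.prime_two]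

theorem stmt10 (p r q s : ℕ) (hp : p.Prime) (hodd : p ≠ 2) (hr : 1 ≤ r)
    (hq : q = p ^ r) (hq4 : q % 4 = 3) (hs : s = padicValNat 2 (q + 1) + 1)
    -- `SD` is the semidihedral group of order `2 ^ (s + 1)`:
    (SD : Type*) [Group SD] [Fintype SD] (x y : SD)
    (hcard : Fintype.card SD = 2 ^ (s + 1))
    (hx : orderOf x = 2 ^ s) (hy : y ^ 2 = 1)
    (hxy : y * x * y = x ^ (2 ^ (s - 1) - 1))
    (hgen : Subgroup.closure {x, y} = ⊤)
    (F : Type*) [Field F] [Fintype F] (hF : Fintype.card F = q)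
    (m : ℕ) (hm : 1 ≤ m)
    (Q : Sylow 2 (Equiv.Perm (Fin m))) :
    (∀ P : Sylow 2 (Matrix.GeneralLinearGroup (Fin (2 * m)) F),
      Nonempty
        (↥P ≃*
          SemidirectProduct (Fin m → SD) ↥Q
            ((permAction m SD).comp (Q : Subgroup (Equiv.Perm (Fin m))).subtype))) ∧
    (∀ P' : Sylow 2 (Matrix.GeneralLinearGroup (Fin (2 * m + 1)) F),
      Nonempty
        (↥P' ≃*
          (SemidirectProduct (Fin m → SD) ↥Q
            ((permAction m SD).comp (Q : Subgroup (Equiv.Perm (Fin m))).subtype)) ×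
          Multiplicative (ZMod 2))) := by
  have : Fact p.Prime := ⟨hp⟩
  have : CharP F p := by
    obtain ⟨l, hl⟩ := CharP.exists F
    obtain ⟨n, hlp, hn⟩ := FiniteField.card F l
    rw [hF, hq] at hn
    rwa [(Nat.prime_dvd_prime_iff_eq hp hlp).1 (hp.dvd_of_dvd_pow (hn ▸ dvd_pow_self p (by lia)))]
  subst hF
  have hoddF : Odd (Fintype.card F) := Nat.odd_iff.2 (by lia)
  have hcard' : Nat.card SD = 2 ^ (s + 1) := by rw [Nat.card_eq_fintype_card, hcard]
  have hfac : (Nat.card (Matrix.GeneralLinearGroup (Fin (2 * m)) F)).factorization 2 =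
      (s + 1) * m + padicValNat 2 m.factorial := by
    rw [factorization_card_GL_two hoddF, sum_padicValNat_two_pow_sub_one hq4, hs]
  have hfac' : (Nat.card (Matrix.GeneralLinearGroup (Fin (2 * m + 1)) F)).factorization 2 =
      (s + 1) * m + padicValNat 2 m.factorial + 1 := by
    rw [factorization_card_GL_two hoddF, Finset.sum_range_succ,
      sum_padicValNat_two_pow_sub_one hq4, padicValNat_two_pow_sub_one_of_odd hq4 ⟨m, rfl⟩, hs]
  obtain ⟨ρ, hρ⟩ := exists_injective_semidihedral_representation F p hq4 hs hcard' hx hy hxy hgen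
  have hw := wreathRepresentation_injective ρ hρ m (Q : Subgroup (Equiv.Perm (Fin m)))
  have hrank : Module.finrank F (Fin m → FiniteField.Extension F p 2) = 2 * m := by
    rw [Module.finrank_pi_fintype]
    simp [FiniteField.finrank_extension, mul_comm]
  refine ⟨fun P ↦ P.nonempty_mulEquiv_of_representation _ hw hrank ?_, fun P ↦ ?_⟩
  · rw [card_wreath, hcard', hfac, ← pow_mul, ← pow_add]
  · have hneg : (-1 : F) ≠ 1 :=
      Ring.neg_one_ne_one_of_char_ne_two (by rwa [ringChar.eq F p])
    obtain ⟨τ, hτ⟩ := exists_injective_sign_representation F hneg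
    refine P.nonempty_mulEquiv_of_representation _
      (Representation.externalSum_injective hw hτ) ?_ ?_
    · rw [Module.finrank_prod, hrank, Module.finrank_self]
    · rw [Nat.card_prod, card_wreath, hcard', hfac', ← pow_mul, ← pow_add, pow_succ]
      simp
end
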